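/- arXiv:1805.08851 — 2 statements merged into one kernel-verified Lean document; each statement's English description precedes it below -/
import Mathlib

section
/- Let K be a number field with ring of integers O_K, and let v be a nonzero prime ideal of O_K whose residue field O_K/v has odd characteristic. Let s, t ∈ O_K with t ≠ 0 and with the v-adic valuation of s equal to 0. Then there exist y, z in the v-adic completion K_v with y² − s·z² = t if and only if (the v-adic valuation of t is even, or the image of s in the residue field O_K/v is a square in O_K/v). -/
open NumberField IsDedekindDomain

open scoped WithZero

/-- In a complete ultrametric field in which `2` is a unit, every element close to `1` is a
square. -/
theorem isSquare_of_norm_sub_one_lt_one {L : Type*} [NormedField L] [IsUltrametricDist L]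
    [CompleteSpace L] (h2 : ‖(2 : L)‖ = 1) {a : L} (ha : ‖a - 1‖ < 1) : IsSquare a := by
  have h20 : (2 : L) ≠ 0 := norm_ne_zero_iff.mp (by simp [h2])
  set b := a - 1 with hb
  let f : L → L := fun x ↦ (b - x ^ 2) / 2
  have hmaps : Set.MapsTo f (Metric.closedBall 0 ‖b‖) (Metric.closedBall 0 ‖b‖) := by
    intro x hx
    rw [mem_closedBall_zero_iff] at hx ⊢
    simp only [f, norm_div, h2, div_one]
    rw [sub_eq_add_neg]
    refine (IsUltrametricDist.norm_add_le_max _ _).trans (max_le le_rfl ?_)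
    rw [norm_neg, norm_pow]
    nlinarith [norm_nonneg x]
  have hcontr : ContractingWith ‖b‖₊ (hmaps.restrict f _ _) := by
    refine ⟨by exact_mod_cast ha, LipschitzWith.of_dist_le_mul fun x y ↦ ?_⟩
    have hx := mem_closedBall_zero_iff.mp x.2
    have hy := mem_closedBall_zero_iff.mp y.2
    have hxy : f x - f y = (y + x) * (y - x) / 2 := by simp only [f]; ring
    rw [Subtype.dist_eq, Subtype.dist_eq, dist_eq_norm, dist_eq_norm]
    simp only [Set.MapsTo.val_restrict_apply, hxy, norm_div, h2, div_one, norm_mul, coe_nnnorm]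
    rw [norm_sub_rev (y : L)]
    gcongr
    exact (IsUltrametricDist.norm_add_le_max _ _).trans (max_le hy hx)
  obtain ⟨x, -, hx, -⟩ := hcontr.exists_fixedPoint' Metric.isClosed_closedBall.isComplete hmaps
    (x := 0) (by simp) (edist_ne_top _ _)
  have hx' : (b - x ^ 2) / 2 = x := hx
  rw [div_eq_iff h20] at hx'
  exact ⟨1 + x, by linear_combination hx' - hb⟩

namespace IsDedekindDomain.HeightOneSpectrum

variable {K : Type*} [Field K] [NumberField K] (v : HeightOneSpectrum (𝓞 K))

/-- The valuation of the completion extends the `v`-adic valuation of `𝓞 K`. -/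
theorem valued_algebraMap_eq (r : 𝓞 K) :
    Valued.v (algebraMap (𝓞 K) (v.adicCompletion K) r) = v.intValuation r :=
  (valuedAdicCompletion_eq_valuation v r).trans (v.valuation_of_algebraMap r)

theorem valued_algebraMap_lt_one_iff (r : 𝓞 K) :
    Valued.v (algebraMap (𝓞 K) (v.adicCompletion K) r) < 1 ↔ r ∈ v.asIdeal := by
  rw [valued_algebraMap_eq, intValuation_lt_one_iff_mem]

theorem valued_algebraMap_le_one (r : 𝓞 K) :
    Valued.v (algebraMap (𝓞 K) (v.adicCompletion K) r) ≤ 1 := by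
  rw [valued_algebraMap_eq]
  exact v.intValuation_le_one r

theorem valued_algebraMap_eq_one_iff (r : 𝓞 K) :
    Valued.v (algebraMap (𝓞 K) (v.adicCompletion K) r) = 1 ↔ r ∉ v.asIdeal := by
  rw [valued_algebraMap_eq, intValuation_eq_one_iff]

/-- An element of `K_v` congruent to the square of a unit is a square when `2` is a unit. -/
theorem isSquare_of_valued_sub_lt_one
    (h2 : Valued.v (2 : v.adicCompletion K) = 1) {a b : v.adicCompletion K}
    (hb : Valued.v b = 1) (hab : Valued.v (a - b ^ 2) < 1) : IsSquare a := by
  have hb0 : b ≠ 0 := by rintro rfl; simp at hb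
  have : IsUltrametricDist (v.adicCompletion K) :=
    inferInstanceAs (@IsUltrametricDist _ (Valued.toNormedField (v.adicCompletion K) ℤᵐ⁰).toDist)
  have h2' : ‖(2 : v.adicCompletion K)‖ = 1 := by simp [FinitePlace.norm_def, h2]
  have h : IsSquare (a / b ^ 2) := by
    refine isSquare_of_norm_sub_one_lt_one h2' (Valued.toNormedField.norm_lt_one_iff.mpr ?_)
    rwa [div_sub_one (pow_ne_zero 2 hb0), map_div₀, map_pow, hb, one_pow, div_one]
  obtain ⟨c, hc⟩ := h
  rw [div_eq_iff (pow_ne_zero 2 hb0)] at hc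
  exact ⟨c * b, by rw [hc]; ring⟩

/-- Every `v`-adic integer is congruent to an element of `𝓞 K`. -/
theorem exists_valued_sub_algebraMap_lt_one {x : v.adicCompletion K} (hx : Valued.v x ≤ 1) :
    ∃ r : 𝓞 K, Valued.v (x - algebraMap (𝓞 K) (v.adicCompletion K) r) < 1 := by
  obtain ⟨k, hk⟩ := (denseRange_algebraMap (R := 𝓞 K) K v).exists_dist_lt x one_pos
  rw [dist_eq_norm] at hk
  replace hk := Valued.toNormedField.norm_lt_one_iff.mp hk
  have hk1 : v.valuation K k ≤ 1 := by
    rw [← valuedAdicCompletion_eq_valuation']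
    have := Valued.v.map_sub_le hx hk.le
    rwa [sub_sub_cancel] at this
  obtain ⟨r, hr⟩ := v.exists_valuation_sub_lt_of_integer hk1 1
  refine ⟨r, ?_⟩
  rw [Units.val_one, Valuation.map_sub_swap, ← valuedAdicCompletion_eq_valuation'] at hr
  have h := Valued.v.map_add_lt hk hr
  change Valued.v (x - algebraMap K _ k +
    algebraMap K (v.adicCompletion K) (k - algebraMap (𝓞 K) K r)) < 1 at h
  rwa [map_sub, sub_add_sub_cancel, ← IsScalarTower.algebraMap_apply] at h

/-- A quadratic form `y² - s z²` with unit coefficient represents every unit when the residue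
characteristic is odd. -/
theorem exists_sq_sub_mul_sq_eq_of_valued_eq_one (hodd : ringChar (𝓞 K ⧸ v.asIdeal) ≠ 2)
    (h2 : Valued.v (2 : v.adicCompletion K) = 1) {s : 𝓞 K} (hs : s ∉ v.asIdeal)
    {w : v.adicCompletion K} (hw : Valued.v w = 1) :
    ∃ y z : v.adicCompletion K, y ^ 2 - algebraMap (𝓞 K) (v.adicCompletion K) s * z ^ 2 = w := by
  obtain ⟨r, hr⟩ := v.exists_valued_sub_algebraMap_lt_one hw.le
  have hs1 := (v.valued_algebraMap_eq_one_iff s).mpr hs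
  have hs0 : algebraMap (𝓞 K) (v.adicCompletion K) s ≠ 0 := by
    intro h
    simp [h] at hs1
  let : Field (𝓞 K ⧸ v.asIdeal) := Ideal.Quotient.field _
  have : Finite (𝓞 K ⧸ v.asIdeal) := Ideal.finiteQuotientOfFreeOfNeBot _ v.ne_bot
  let : Fintype (𝓞 K ⧸ v.asIdeal) := Fintype.ofFinite _
  let q := Ideal.Quotient.mk v.asIdeal
  have hqs : q s ≠ 0 := fun h ↦ hs (Ideal.Quotient.eq_zero_iff_mem.mp h)
  obtain ⟨y', z', hyz⟩ := FiniteField.exists_root_sum_quadratic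
    (f := Polynomial.X ^ 2 - Polynomial.C (q r)) (g := Polynomial.C (-q s) * Polynomial.X ^ 2)
    (Polynomial.degree_X_pow_sub_C (by decide) _)
    (Polynomial.degree_C_mul_X_pow 2 (neg_ne_zero.mpr hqs))
    (FiniteField.odd_card_of_char_ne_two hodd)
  obtain ⟨y, rfl⟩ := Ideal.Quotient.mk_surjective y'
  obtain ⟨z, rfl⟩ := Ideal.Quotient.mk_surjective z'
  have hmem : r - (y ^ 2 - s * z ^ 2) ∈ v.asIdeal := by
    rw [← Ideal.Quotient.eq_zero_iff_mem]
    simp only [Polynomial.eval_sub, Polynomial.eval_pow, Polynomial.eval_X, Polynomial.eval_C,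
      Polynomial.eval_mul, q] at hyz
    simp only [map_sub, map_mul, map_pow]
    linear_combination -hyz
  have hclose := Valued.v.map_add_lt hr ((v.valued_algebraMap_lt_one_iff _).mpr hmem)
  simp only [map_sub, map_mul, map_pow, sub_add_sub_cancel] at hclose
  by_cases hy : y ∈ v.asIdeal
  · have hz : z ∉ v.asIdeal := by
      intro hz
      have hrv : r ∈ v.asIdeal := by
        have := v.asIdeal.add_mem hmem (v.asIdeal.sub_mem (v.asIdeal.pow_mem_of_mem hy 2 two_pos)
          (v.asIdeal.mul_mem_left s (v.asIdeal.pow_mem_of_mem hz 2 two_pos)))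
        rwa [sub_add_cancel] at this
      have := Valued.v.map_add_lt hr ((v.valued_algebraMap_lt_one_iff r).mpr hrv)
      rw [sub_add_cancel, hw] at this
      exact this.false
    obtain ⟨c, hc⟩ := v.isSquare_of_valued_sub_lt_one h2
      (a := (algebraMap (𝓞 K) (v.adicCompletion K) y ^ 2 - w) / algebraMap (𝓞 K) _ s)
      ((v.valued_algebraMap_eq_one_iff z).mpr hz) (by
        rw [div_sub' hs0, map_div₀, hs1, div_one, Valuation.map_sub_swap]
        convert hclose using 2
        ring)
    refine ⟨algebraMap (𝓞 K) _ y, c, ?_⟩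
    rw [sq c, ← hc]
    field_simp
    ring
  · obtain ⟨c, hc⟩ := v.isSquare_of_valued_sub_lt_one h2
      (a := w + algebraMap (𝓞 K) _ s * algebraMap (𝓞 K) _ z ^ 2)
      ((v.valued_algebraMap_eq_one_iff y).mpr hy) (by convert hclose using 2; ring)
    exact ⟨c, algebraMap (𝓞 K) _ z, by rw [sq c, ← hc]; ring⟩

/-- If `s` is not a square modulo `v`, every nonzero value of `y² - s z²` has even valuation. -/
theorem exists_valued_sq_sub_mul_sq_eq_sq {s : 𝓞 K} (hs : s ∉ v.asIdeal)
    (hsq : ¬ ∃ u : 𝓞 K, s - u ^ 2 ∈ v.asIdeal) (y z : v.adicCompletion K) :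
    ∃ x : v.adicCompletion K,
      Valued.v (y ^ 2 - algebraMap (𝓞 K) (v.adicCompletion K) s * z ^ 2) = Valued.v x ^ 2 := by
  set S := algebraMap (𝓞 K) (v.adicCompletion K) s
  have hs1 : Valued.v S = 1 := (v.valued_algebraMap_eq_one_iff s).mpr hs
  have hSz : Valued.v (S * z ^ 2) = Valued.v z ^ 2 := by rw [map_mul, hs1, one_mul, map_pow]
  rcases lt_trichotomy (Valued.v y) (Valued.v z) with h | h | h
  · refine ⟨z, ?_⟩
    rw [Valuation.map_sub_eq_of_lt_right, hSz]
    rw [hSz, map_pow]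
    exact pow_lt_pow_left₀ h zero_le two_ne_zero
  · refine ⟨z, ?_⟩
    rcases eq_or_ne z 0 with rfl | hz
    · simp_all
    have hz' : Valued.v z ≠ 0 := Valued.v.ne_zero_iff.mpr hz
    have hu : Valued.v (y / z) = 1 := by rw [map_div₀, h, div_self hz']
    have hle : Valued.v ((y / z) ^ 2 - S) ≤ 1 :=
      Valued.v.map_sub_le (by rw [map_pow, hu, one_pow]) hs1.le
    have hone : Valued.v ((y / z) ^ 2 - S) = 1 := by
      refine hle.antisymm (not_lt.mp fun hlt ↦ hsq ?_)
      obtain ⟨u, hu'⟩ := v.exists_valued_sub_algebraMap_lt_one hu.le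
      refine ⟨u, ?_⟩
      have hadd : Valued.v (y / z + algebraMap (𝓞 K) (v.adicCompletion K) u) ≤ 1 :=
        Valued.v.map_add_le hu.le (v.valued_algebraMap_le_one u)
      have hmul : Valued.v ((y / z - algebraMap (𝓞 K) (v.adicCompletion K) u) *
          (y / z + algebraMap (𝓞 K) (v.adicCompletion K) u)) < 1 := by
        rw [map_mul]
        exact mul_lt_one_of_lt_of_le hu' hadd
      rw [← valued_algebraMap_lt_one_iff]
      convert Valued.v.map_sub_lt hmul hlt using 2
      rw [map_sub, map_pow]
      ring
    have : y ^ 2 - S * z ^ 2 = ((y / z) ^ 2 - S) * z ^ 2 := by field_simp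
    rw [this, map_mul, hone, one_mul, map_pow]
  · refine ⟨y, ?_⟩
    rw [Valuation.map_sub_eq_of_lt_left, map_pow]
    rw [hSz, map_pow]
    exact pow_lt_pow_left₀ h zero_le two_ne_zero

theorem intValuation_eq_exp_neg_iff {t : 𝓞 K} (ht : t ≠ 0) (n : ℕ) :
    v.intValuation t = WithZero.exp (-(n : ℤ)) ↔
      v.asIdeal ^ n ∣ Ideal.span {t} ∧ ¬ v.asIdeal ^ (n + 1) ∣ Ideal.span {t} := by
  rw [← intValuation_le_pow_iff_dvd, ← intValuation_le_pow_iff_dvd,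
    v.intValuation_eq_exp_neg_multiplicity ht]
  simp only [WithZero.exp_inj, WithZero.exp_le_exp]
  lia

theorem valued_two_eq_one (hodd : ringChar (𝓞 K ⧸ v.asIdeal) ≠ 2) :
    Valued.v (2 : v.adicCompletion K) = 1 := by
  have h : (2 : 𝓞 K) ∉ v.asIdeal := by
    intro h
    have : Nontrivial (𝓞 K ⧸ v.asIdeal) := Ideal.Quotient.nontrivial_iff.mpr v.isPrime.ne_top
    let : Field (𝓞 K ⧸ v.asIdeal) := Ideal.Quotient.field _
    exact Ring.two_ne_zero hodd
      ((map_ofNat _ 2).symm.trans (Ideal.Quotient.eq_zero_iff_mem.mpr h))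
  rw [← map_ofNat (algebraMap (𝓞 K) (v.adicCompletion K)) 2]
  exact (v.valued_algebraMap_eq_one_iff 2).mpr h

end IsDedekindDomain.HeightOneSpectrum

open IsDedekindDomain.HeightOneSpectrum in
/-- Lemma 2.2: for an odd place `v` of `K` and `s, t ∈ 𝓞 K` with `v s = 0` and `t ≠ 0`,
the equation `y² - s z² = t` has a solution in the `v`-adic completion `K_v` iff
`v t` is even or `s` is a square modulo `v`. -/
theorem stmt_1 (K : Type*) [Field K] [NumberField K]
    (v : HeightOneSpectrum (𝓞 K))
    (hodd : ringChar (𝓞 K ⧸ v.asIdeal) ≠ 2)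
    (s t : 𝓞 K) (ht : t ≠ 0) (hs : s ∉ v.asIdeal) :
    (∃ y z : v.adicCompletion K,
        y ^ 2 - algebraMap (𝓞 K) (v.adicCompletion K) s * z ^ 2 =
          algebraMap (𝓞 K) (v.adicCompletion K) t) ↔
      ((∃ n : ℕ, Even n ∧ v.asIdeal ^ n ∣ Ideal.span {t} ∧
          ¬ v.asIdeal ^ (n + 1) ∣ Ideal.span {t}) ∨
        ∃ u : 𝓞 K, s - u ^ 2 ∈ v.asIdeal) := by
  have h2 := v.valued_two_eq_one hodd
  have h20 : (2 : v.adicCompletion K) ≠ 0 := by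
    intro h
    simp [h] at h2
  simp_rw [← v.intValuation_eq_exp_neg_iff ht]
  constructor
  · rintro ⟨y, z, h⟩
    refine or_iff_not_imp_right.mpr fun hsq ↦ ?_
    obtain ⟨x, hx⟩ := v.exists_valued_sq_sub_mul_sq_eq_sq hs hsq y z
    rw [h, valued_algebraMap_eq, v.intValuation_eq_exp_neg_multiplicity ht] at hx
    have hx0 : Valued.v x ≠ 0 := by
      intro h0
      simp [h0] at hx
    refine ⟨_, ?_, v.intValuation_eq_exp_neg_multiplicity ht⟩
    rw [← WithZero.exp_log hx0, ← WithZero.exp_nsmul, WithZero.exp_inj] at hx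
    rw [← Int.even_coe_nat, ← even_neg, hx]
    simp
  · rintro (⟨n, ⟨m, rfl⟩, hn⟩ | ⟨u, hu⟩)
    · obtain ⟨p, hp⟩ := v.intValuation_exists_uniformizer
      set P := algebraMap (𝓞 K) (v.adicCompletion K) p
      have hP : Valued.v P = WithZero.exp (-1 : ℤ) := (v.valued_algebraMap_eq p).trans hp
      have hP0 : P ≠ 0 := by
        intro h
        rw [h, map_zero] at hP
        exact WithZero.exp_ne_zero hP.symm
      obtain ⟨y, z, h⟩ := v.exists_sq_sub_mul_sq_eq_of_valued_eq_one hodd h2 hs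
        (w := algebraMap (𝓞 K) (v.adicCompletion K) t / P ^ (m + m)) (by
          rw [map_div₀, valued_algebraMap_eq, hn, map_pow, hP, ← WithZero.exp_nsmul,
            nsmul_eq_mul, mul_neg_one, div_self WithZero.exp_ne_zero])
      rw [eq_div_iff (pow_ne_zero _ hP0)] at h
      exact ⟨y * P ^ m, z * P ^ m, by rw [← h]; ring⟩
    · have hu' : u ∉ v.asIdeal := fun h ↦ hs <| by
        simpa using v.asIdeal.add_mem hu (v.asIdeal.pow_mem_of_mem h 2 two_pos)
      obtain ⟨c, hc⟩ := v.isSquare_of_valued_sub_lt_one h2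
        ((v.valued_algebraMap_eq_one_iff u).mpr hu')
        (by rw [← map_pow, ← map_sub]; exact (v.valued_algebraMap_lt_one_iff _).mpr hu)
      have hc0 : c ≠ 0 := by
        rintro rfl
        have hs1 := (v.valued_algebraMap_eq_one_iff s).mpr hs
        simp [hc] at hs1
      set T := algebraMap (𝓞 K) (v.adicCompletion K) t
      refine ⟨(T + 1) / 2, (T - 1) / (2 * c), ?_⟩
      rw [hc]
      field_simp
      ring
end

section
/- Let K be a number field with ring of integers O_K. Let s, t ∈ O_K be elements generating distinct prime ideals (s) and (t) of O_K, each of whose residue fields has odd characteristic. Assume that s ≡ 1 mod 8·O_K or t ≡ 1 mod 8·O_K, and assume that for every real embedding σ : K → ℝ, σ(s) > 0 or σ(t) > 0. Then there exists u ∈ O_K with s ≡ u² mod (t) if and only if there exists w ∈ O_K with t ≡ w² mod (s). -/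
open NumberField

section GaussOne
open Complex Filter Topology

theorem Complex.ofReal_mul_cpow {r : ℝ} (hr : 0 < r) {z : ℂ} (hz : z ≠ 0) (w : ℂ) :
    ((r : ℂ) * z) ^ w = (r : ℂ) ^ w * z ^ w := by
  have hr0 : (r : ℂ) ≠ 0 := by exact_mod_cast hr.ne'
  rw [cpow_def_of_ne_zero (mul_ne_zero hr0 hz), cpow_def_of_ne_zero hr0, cpow_def_of_ne_zero hz,
    log_ofReal_mul hr hz, ofReal_log hr.le, add_mul, Complex.exp_add]

theorem tendsto_jacobiTheta₂_real_I_mul (x : ℝ) :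
    Tendsto (fun T : ℝ => jacobiTheta₂ x (I * T)) atTop (𝓝 1) := by
  have h1 : (1 : ℂ) = ∑' n : ℤ, if n = 0 then 1 else 0 := by
    rw [tsum_ite_eq]
  rw [h1]
  unfold jacobiTheta₂
  refine tendsto_tsum_of_dominated_convergence
    (bound := fun n : ℤ => ‖jacobiTheta₂_term n x I‖) ?_ ?_ ?_
  · exact ((summable_jacobiTheta₂_term_iff _ _).mpr (by simp)).norm
  · intro n
    split_ifs with hn
    · subst hn
      simp [jacobiTheta₂_term]
    · rw [tendsto_zero_iff_norm_tendsto_zero]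
      simp_rw [norm_jacobiTheta₂_term]
      refine Real.tendsto_exp_atBot.comp ?_
      have : 0 < Real.pi * (n : ℝ) ^ 2 := by positivity
      have h2 := (tendsto_id (α := ℝ) (x := atTop)).const_mul_atTop_of_neg (neg_lt_zero.mpr this)
      refine h2.congr fun T => ?_
      simp
  · filter_upwards [eventually_ge_atTop (1 : ℝ)] with T hT n
    simp_rw [norm_jacobiTheta₂_term]
    refine Real.exp_le_exp.mpr ?_
    have : 0 ≤ Real.pi * (n : ℝ) ^ 2 := by positivity
    simp
    nlinarith

theorem jacobiTheta_inv_add_I_mul (N : ℕ) [NeZero N] (hN : Even N) {y : ℝ} (hy : 0 < y) :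
    jacobiTheta (1 / N + I * y) = 1 / (N * (y : ℂ) ^ (1 / 2 : ℂ)) *
      ∑ r : Fin N, cexp (Real.pi * I * r ^ 2 / N) *
        jacobiTheta₂ ((r / N : ℝ) : ℂ) (I * ((1 / (N ^ 2 * y) : ℝ) : ℂ)) := by
  have hN0 : (N : ℂ) ≠ 0 := NeZero.ne _
  have hNpos : (0 : ℝ) < N := Nat.cast_pos.mpr (NeZero.pos N)
  have hyc : (y : ℂ) ≠ 0 := by exact_mod_cast hy.ne'
  have him : 0 < (1 / N + I * y : ℂ).im := by
    simp [← ofReal_natCast, ← ofReal_inv, hy]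
  have hinner (r : Fin N) : ∑' m : ℤ, cexp (Real.pi * I * (m * N + r) ^ 2 * (1 / N + I * y)) =
      1 / (N * (y : ℂ) ^ (1 / 2 : ℂ)) * (cexp (Real.pi * I * r ^ 2 / N) *
        jacobiTheta₂ ((r / N : ℝ) : ℂ) (I * ((1 / (N ^ 2 * y) : ℝ) : ℂ))) := by
    have h1 (m : ℤ) : cexp (Real.pi * I * (m * N + r) ^ 2 * (1 / N + I * y)) =
        cexp (Real.pi * I * r ^ 2 / N) * (cexp (-Real.pi * y * r ^ 2) *
          jacobiTheta₂_term m (I * y * N * r) (I * (N ^ 2 * y))) := by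
      obtain ⟨a, ha⟩ := hN
      have ha' : (N : ℂ) = a + a := by exact_mod_cast ha
      unfold jacobiTheta₂_term
      rw [← Complex.exp_add, ← Complex.exp_add, Complex.exp_eq_exp_iff_exists_int]
      refine ⟨m ^ 2 * a + m * r, ?_⟩
      have e : (m * N + r : ℂ) ^ 2 * (1 / N + I * y) =
        m ^ 2 * N + 2 * m * r + r ^ 2 / N + I * y * (m * N + r) ^ 2 := by
        field_simp
        ring
      rw [mul_assoc, e]
      push_cast
      rw [ha']
      linear_combination (Real.pi * y * r ^ 2) * I_mul_I
    simp_rw [h1]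
    rw [tsum_mul_left, tsum_mul_left, ← jacobiTheta₂, jacobiTheta₂_functional_equation]
    have e1 : (-I * (I * (N ^ 2 * y)) : ℂ) = ((N ^ 2 : ℝ) : ℂ) * (y : ℝ) := by
      push_cast
      linear_combination (-(N : ℂ) ^ 2 * y) * I_mul_I
    have e2 : ((((N ^ 2 : ℝ) : ℂ) * (y : ℝ)) ^ (1 / 2 : ℂ) : ℂ) = N * (y : ℂ) ^ (1 / 2 : ℂ) := by
      rw [mul_cpow_ofReal_nonneg (by positivity) hy.le]
      congr 1
      rw [show (1 / 2 : ℂ) = ((1 / 2 : ℝ) : ℂ) by push_cast; rfl, ← ofReal_cpow (by positivity),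
        ← Real.sqrt_eq_rpow, Real.sqrt_sq hNpos.le]
      simp
    have e3 : (I * y * N * r / (I * (N ^ 2 * y)) : ℂ) = ((r / N : ℝ) : ℂ) := by
      push_cast
      field_simp
    have e4 : (-1 / (I * (N ^ 2 * y)) : ℂ) = I * ((1 / (N ^ 2 * y) : ℝ) : ℂ) := by
      push_cast
      field_simp
      simp
    rw [e1, e2, e3, e4]
    have e5 : cexp (-Real.pi * y * r ^ 2) *
        cexp (-Real.pi * I * (I * y * N * r) ^ 2 / (I * (N ^ 2 * y))) = 1 := by
      rw [← Complex.exp_add, ← Complex.exp_zero]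
      congr 1
      field_simp
      linear_combination (-Real.pi * y * r ^ 2 ) * I_sq
    linear_combination (cexp (Real.pi * I * r ^ 2 / N) * (1 / (N * (y : ℂ) ^ (1 / 2 : ℂ))) *
      jacobiTheta₂ ((r / N : ℝ) : ℂ) (I * ((1 / (N ^ 2 * y) : ℝ) : ℂ))) * e5
  have hs : Summable fun n : ℤ => cexp (Real.pi * I * n ^ 2 * (1 / N + I * y)) := by
    have := (summable_jacobiTheta₂_term_iff 0 _).mpr him
    refine this.congr fun n => ?_
    simp [jacobiTheta₂_term]
  let e : Fin N × ℤ ≃ ℤ := (Equiv.prodComm _ _).trans (Int.divModEquiv N).symm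
  rw [jacobiTheta, ← e.tsum_eq, Finset.mul_sum]
  refine (Summable.tsum_prod ((Equiv.summable_iff e).mpr hs)).trans ?_
  rw [tsum_fintype]
  refine Finset.sum_congr rfl fun r _ => ?_
  rw [← hinner]
  simp [e, Int.divModEquiv]

theorem jacobiTheta_inv_add_I_mul' (a : ℕ) [NeZero a] {y : ℝ} (hy : 0 < y) :
    jacobiTheta (1 / (2 * a) + I * y) = 1 / (-I * (1 / (2 * a) + I * y)) ^ (1 / 2 : ℂ) *
      (1 / ((y : ℂ) ^ (1 / 2 : ℂ) * (2 * a / (1 / (2 * a) + I * y)) ^ (1 / 2 : ℂ))) *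
      jacobiTheta (I * ((1 / (4 * a ^ 2 * y) : ℝ) : ℂ) - 1 / (2 * a)) := by
  have hper (n : ℕ) (τ : ℂ) : jacobiTheta (2 * n + τ) = jacobiTheta τ := by
    induction n with
    | zero => simp
    | succ k ih => rw [← ih, ← jacobiTheta_two_add (2 * k + τ)]; congr 1; push_cast; ring
  have ha : (0 : ℝ) < a := Nat.cast_pos.mpr (NeZero.pos a)
  have hac : (a : ℂ) ≠ 0 := NeZero.ne _
  have hyc : (y : ℂ) ≠ 0 := by exact_mod_cast hy.ne'
  set τ : ℂ := 1 / (2 * a) + I * y with hτ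
  have him : τ.im = y := by
    simp [hτ, ← ofReal_natCast, ← ofReal_inv, ← ofReal_ofNat, ← ofReal_mul]
  have hτ0 : τ ≠ 0 := by
    intro h
    rw [h] at him
    simp at him
    exact hy.ne him
  have e1 : -1 / τ = -(2 * a) + I * (y * (2 * a / τ)) := by
    field_simp
    rw [hτ]
    field_simp
    ring
  have e2 : -1 / (I * (y * (2 * a / τ))) = I * ((1 / (4 * a ^ 2 * y) : ℝ) : ℂ) - 1 / (2 * a) := by
    push_cast
    field_simp
    rw [hτ]
    field_simp
    linear_combination (-4 : ℂ) * I_sq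
  have e3 : -I * (I * (y * (2 * a / τ))) = ((y : ℝ) : ℂ) * (2 * a / τ) := by
    linear_combination (-(y * (2 * a / τ)) : ℂ) * I_mul_I
  rw [jacobiTheta_eq_jacobiTheta₂, jacobiTheta₂_functional_equation]
  simp only [ne_eq, OfNat.ofNat_ne_zero, not_false_eq_true, zero_pow, mul_zero, zero_div,
    Complex.exp_zero, mul_one]
  rw [e1, ← jacobiTheta_eq_jacobiTheta₂, ← hper a, mul_assoc]
  congr 1
  rw [show 2 * (a : ℂ) + (-(2 * a) + I * (y * (2 * a / τ))) = I * (y * (2 * a / τ)) by ring,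
    jacobiTheta_eq_jacobiTheta₂, jacobiTheta₂_functional_equation]
  simp only [ne_eq, OfNat.ofNat_ne_zero, not_false_eq_true, zero_pow, mul_zero, zero_div,
    Complex.exp_zero, mul_one]
  rw [e2, e3, ← jacobiTheta_eq_jacobiTheta₂]
  congr 3
  rw [Complex.ofReal_mul_cpow hy (by simp [hτ0, hac])]

theorem sum_exp_sq_div (a : ℕ) [NeZero a] :
    ∑ r : Fin (2 * a), cexp (Real.pi * I * r ^ 2 / (2 * a)) =
      Real.sqrt (2 * a) * cexp (Real.pi * I / 4) := by
  have ha : (0 : ℝ) < a := Nat.cast_pos.mpr (NeZero.pos a)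
  have hac : (a : ℂ) ≠ 0 := NeZero.ne _
  have hT : Tendsto (fun y : ℝ => 1 / ((2 * a : ℝ) ^ 2 * y)) (𝓝[>] 0) atTop := by
    have : 0 < 1 / (2 * a : ℝ) ^ 2 := by positivity
    refine (tendsto_inv_nhdsGT_zero.const_mul_atTop this).congr fun y => ?_
    field_simp
  have hL : Tendsto (fun y : ℝ => ∑ r : Fin (2 * a), cexp (Real.pi * I * r ^ 2 / (2 * a : ℕ)) *
        jacobiTheta₂ ((r / (2 * a : ℕ) : ℝ) : ℂ) (I * ((1 / ((2 * a : ℕ) ^ 2 * y) : ℝ) : ℂ)))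
      (𝓝[>] 0) (𝓝 (∑ r : Fin (2 * a), cexp (Real.pi * I * r ^ 2 / (2 * a)) * 1)) := by
    refine tendsto_finsetSum _ fun r _ => ?_
    push_cast
    refine Tendsto.const_mul _ ?_
    have := (tendsto_jacobiTheta₂_real_I_mul (r / (2 * a))).comp hT
    refine this.congr fun y => ?_
    simp
  have hR : Tendsto (fun y : ℝ => 2 * a * (1 / (-I * (1 / (2 * a) + I * y)) ^ (1 / 2 : ℂ) *
      (1 / (2 * a / (1 / (2 * a) + I * y)) ^ (1 / 2 : ℂ))) *
      jacobiTheta (I * ((1 / ((2 * a) ^ 2 * y) : ℝ) : ℂ) - 1 / (2 * a)))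
      (𝓝[>] 0) (𝓝 (2 * a * (1 / (-I * (1 / (2 * a) + I * (0 : ℝ))) ^ (1 / 2 : ℂ) *
      (1 / (2 * a / (1 / (2 * a) + I * (0 : ℝ))) ^ (1 / 2 : ℂ))) * 1)) := by
    refine Tendsto.mul ?_ ?_
    · refine Tendsto.const_mul _ (tendsto_nhdsWithin_of_tendsto_nhds ?_)
      refine ContinuousAt.tendsto (f := fun y : ℝ => 1 / (-I * (1 / (2 * a) + I * y)) ^ (1 / 2 : ℂ) *
      (1 / (2 * a / (1 / (2 * a) + I * y)) ^ (1 / 2 : ℂ))) ?_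
      have hre1 : 0 < (1 / (2 * a) + I * (0 : ℝ) : ℂ).re := by
        simp [← ofReal_natCast, ← ofReal_inv, ← ofReal_ofNat, ← ofReal_mul, ha]
      have hne : (1 / (2 * a) + I * (0 : ℝ) : ℂ) ≠ 0 := fun h => by
        rw [h] at hre1
        exact lt_irrefl _ hre1
      have hs1 : (-I * (1 / (2 * a) + I * (0 : ℝ)) : ℂ) ∈ slitPlane := by
        right
        simp [← ofReal_natCast, ← ofReal_inv, ← ofReal_ofNat, ← ofReal_mul, ha.ne']
      have hs2 : (2 * a / (1 / (2 * a) + I * (0 : ℝ)) : ℂ) ∈ slitPlane := by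
        left
        simp [← ofReal_natCast, ← ofReal_inv, ← ofReal_ofNat, ← ofReal_mul, ← ofReal_div, ha]
      have hc1 : (-I * (1 / (2 * a) + I * (0 : ℝ)) : ℂ) ^ (1 / 2 : ℂ) ≠ 0 :=
        fun h => slitPlane_ne_zero hs1 (cpow_eq_zero_iff _ _ |>.mp h).1
      have hc2 : (2 * a / (1 / (2 * a) + I * (0 : ℝ)) : ℂ) ^ (1 / 2 : ℂ) ≠ 0 :=
        fun h => slitPlane_ne_zero hs2 (cpow_eq_zero_iff _ _ |>.mp h).1
      have hcont : ContinuousAt (fun y : ℝ => (1 / (2 * a) + I * y : ℂ)) 0 := by fun_prop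
      refine ContinuousAt.mul ?_ ?_
      · refine continuousAt_const.div₀ ?_ hc1
        exact (continuousAt_const.mul hcont).cpow continuousAt_const hs1
      · refine continuousAt_const.div₀ ?_ hc2
        exact (continuousAt_const.div₀ hcont hne).cpow continuousAt_const hs2
    · rw [tendsto_iff_norm_sub_tendsto_zero]
      have himT (y : ℝ) : (I * ((1 / ((2 * a) ^ 2 * y) : ℝ) : ℂ) - 1 / (2 * a)).im =
          1 / ((2 * a) ^ 2 * y) := by
        rw [sub_im, I_mul_im, ofReal_re]
        simp [← ofReal_natCast, ← ofReal_inv, ← ofReal_ofNat, ← ofReal_mul]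
      have hexp : Tendsto (fun y : ℝ => Real.exp (-Real.pi * (1 / ((2 * a : ℝ) ^ 2 * y))))
          (𝓝[>] 0) (𝓝 0) :=
        Real.tendsto_exp_atBot.comp (hT.const_mul_atTop_of_neg (by linarith [Real.pi_pos]))
      have hb : Tendsto (fun y : ℝ => 2 / (1 - Real.exp (-Real.pi * (1 / ((2 * a : ℝ) ^ 2 * y)))) *
          Real.exp (-Real.pi * (1 / ((2 * a : ℝ) ^ 2 * y)))) (𝓝[>] 0) (𝓝 (2 / (1 - 0) * 0)) :=
        (tendsto_const_nhds.div (tendsto_const_nhds.sub hexp) (by norm_num)).mul hexp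
      rw [mul_zero] at hb
      refine squeeze_zero' (Eventually.of_forall fun _ => norm_nonneg _) ?_ hb
      filter_upwards [self_mem_nhdsWithin] with y hy
      have hy' : (0 : ℝ) < y := hy
      have := norm_jacobiTheta_sub_one_le
        (τ := I * ((1 / ((2 * a) ^ 2 * y) : ℝ) : ℂ) - 1 / (2 * a)) (by rw [himT]; positivity)
      rwa [himT] at this
  have hLR := tendsto_nhds_unique (hL.congr' ?_) hR
  · simp only [mul_one] at hLR
    rw [hLR]
    have e1 : (-I * (1 / (2 * a) + I * (0 : ℝ)) : ℂ) = ((1 / (2 * a) : ℝ) : ℂ) * (-I) := by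
      push_cast; ring
    have e2 : (2 * a / (1 / (2 * a) + I * (0 : ℝ)) : ℂ) = (((2 * a) ^ 2 : ℝ) : ℂ) := by
      push_cast; field_simp; simp
    have hsq (x : ℝ) (hx : 0 ≤ x) : (x : ℂ) ^ (1 / 2 : ℂ) = Real.sqrt x := by
      rw [show (1 / 2 : ℂ) = ((1 / 2 : ℝ) : ℂ) by push_cast; rfl, ← ofReal_cpow hx,
        ← Real.sqrt_eq_rpow]
    rw [e1, e2, Complex.ofReal_mul_cpow (r := 1 / (2 * a)) (by positivity)
      (neg_ne_zero.mpr I_ne_zero), hsq _ (by positivity), hsq _ (by positivity),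
      Real.sqrt_sq (by positivity), cpow_def_of_ne_zero (neg_ne_zero.mpr I_ne_zero), log_neg_I,
      Real.sqrt_div zero_le_one, Real.sqrt_one,
      show (-(Real.pi / 2) * I * (1 / 2) : ℂ) = -(Real.pi * I / 4) by ring, Complex.exp_neg]
    have hs0 : ((Real.sqrt (2 * a) : ℝ) : ℂ) ≠ 0 := by
      have : (0 : ℝ) < Real.sqrt (2 * a) := Real.sqrt_pos.mpr (by positivity)
      exact_mod_cast this.ne'
    have he0 := Complex.exp_ne_zero (Real.pi * I / 4)
    push_cast
    field_simp
  · filter_upwards [self_mem_nhdsWithin] with y hy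
    have hy' : (0 : ℝ) < y := hy
    have h1 := jacobiTheta_inv_add_I_mul (2 * a) (even_two_mul a) hy'
    have h2 := jacobiTheta_inv_add_I_mul' a hy'
    have hy2 : (y : ℂ) ^ (1 / 2 : ℂ) ≠ 0 := fun h =>
      hy'.ne' (by exact_mod_cast (cpow_eq_zero_iff _ _ |>.mp h).1)
    push_cast at h1 h2 ⊢
    rw [h2] at h1
    have h3 := congrArg (fun z => 2 * a * (y : ℂ) ^ (1 / 2 : ℂ) * z) h1
    rw [show (2 * a : ℂ) ^ 2 = 4 * a ^ 2 by ring]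
    rw [show (2 * a : ℂ) ^ 2 = 4 * a ^ 2 by ring] at h3
    have h4 : (2 * a * (y : ℂ) ^ (1 / 2 : ℂ)) * (1 / (2 * a * (y : ℂ) ^ (1 / 2 : ℂ))) = 1 := by
      field_simp
    rw [← mul_assoc _ (1 / (2 * a * (y : ℂ) ^ (1 / 2 : ℂ))), h4, one_mul] at h3
    rw [← h3]
    have h5 : (y : ℂ) ^ (1 / 2 : ℂ) * (1 / (y : ℂ) ^ (1 / 2 : ℂ)) = 1 := by
      field_simp
    rw [← one_div_mul_one_div ((y : ℂ) ^ (1 / 2 : ℂ))]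
    linear_combination (2 * a * (1 / (-I * (1 / (2 * a) + I * y)) ^ (1 / 2 : ℂ) *
      (1 / (2 * a / (1 / (2 * a) + I * y)) ^ (1 / 2 : ℂ))) *
      jacobiTheta (I * ((1 / (4 * a ^ 2 * y)) : ℂ) - 1 / (2 * a))) * h5

end GaussOne

section FiniteGroups
open Finset

theorem sum_eq_sum_filter_of_isotropic {G : Type*} [AddCommGroup G] [Fintype G] (q : G → ℂ)
    (H : AddSubgroup G) (P : G → Prop) [DecidablePred P]
    (hP : ∀ g, P g → ∀ h ∈ H, q (g + h) = q g)
    (hnP : ∀ g, ¬ P g → ∃ h₀ ∈ H, ∃ ω : ℂ, ω ≠ 1 ∧ ∀ h ∈ H, q (g + h + h₀) = ω * q (g + h)) :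
    ∑ g, q g = ∑ g with P g, q g := by
  classical
  have hcard : (Fintype.card H : ℂ) ≠ 0 := Nat.cast_ne_zero.mpr Fintype.card_ne_zero
  have h1 (g : G) : ∑ h : H, q (g + h) = if P g then Fintype.card H * q g else 0 := by
    split_ifs with hg
    · rw [sum_congr rfl fun (h : H) _ => hP g hg h h.2]
      simp
    · obtain ⟨h₀, hh₀, ω, hω, hq⟩ := hnP g hg
      have h2 : ∑ h : H, q (g + h) = ω * ∑ h : H, q (g + h) := by
        rw [mul_sum, ← Equiv.sum_comp (Equiv.addRight (⟨h₀, hh₀⟩ : H))]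
        refine sum_congr rfl fun h _ => ?_
        rw [← hq h h.2]
        simp [add_assoc]
      by_contra hne
      exact hω (mul_right_cancel₀ hne (by rw [← h2, one_mul]))
  have h3 : ∑ g, ∑ h : H, q (g + h) = Fintype.card H * ∑ g, q g := by
    rw [sum_comm, ← nsmul_eq_mul, ← card_univ, ← sum_const]
    refine sum_congr rfl fun h _ => ?_
    exact Equiv.sum_comp (Equiv.addRight (h : G)) q
  simp_rw [h1] at h3
  rw [← sum_filter, ← mul_sum] at h3
  exact (mul_left_cancel₀ hcard h3).symm

theorem exists_sum_range_eq_mul_sum {O G R : Type*} [AddCommGroup O] [AddCommGroup G] [Fintype G]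
    [AddCommGroup R] [Fintype R] (f : O →+ G) (π : O →+ R) (hπ : Function.Surjective π)
    (hker : f.ker ≤ π.ker) (q : G → ℂ) (F : R → ℂ) (hF : ∀ x, q (f x) = F (π x))
    [DecidablePred (· ∈ f.range)] :
    ∃ ρ : ℝ, 0 < ρ ∧ ∑ g with g ∈ f.range, q g = ρ * ∑ r, F r := by
  classical
  let φ : f.range →+ R :=
    (QuotientAddGroup.lift f.ker π hker).comp (QuotientAddGroup.quotientKerEquivRange f).symm
  have hφ (x : O) : φ ⟨f x, x, rfl⟩ = π x := by
    have : (QuotientAddGroup.quotientKerEquivRange f).symm ⟨f x, x, rfl⟩ =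
        QuotientAddGroup.mk x := by
      rw [AddEquiv.symm_apply_eq]
      rfl
    simp [φ, this]
  have hφs : Function.Surjective φ := fun r => by
    obtain ⟨x, rfl⟩ := hπ r
    exact ⟨_, hφ x⟩
  have hq (g : f.range) : q g = F (φ g) := by
    obtain ⟨_, x, rfl⟩ := g
    rw [hφ, ← hF]
  refine ⟨Fintype.card φ.ker, by exact_mod_cast Fintype.card_pos, ?_⟩
  rw [← sum_subtype_eq_sum_filter, mul_sum]
  have h1 : ∑ g ∈ Finset.subtype (· ∈ f.range) univ, q g = ∑ g : f.range, F (φ g) := by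
    refine sum_congr ?_ fun g _ => hq g
    ext; simp
  rw [h1, ← sum_fiberwise_of_maps_to (g := φ) (t := univ) (fun _ _ => mem_univ _)]
  refine sum_congr rfl fun r _ => ?_
  rw [sum_congr rfl fun g hg => by rw [(mem_filter.mp hg).2], sum_const, nsmul_eq_mul]
  congr 1
  obtain ⟨g₀, rfl⟩ := hφs r
  rw [Complex.ofReal_natCast, Nat.cast_inj, ← Fintype.card_subtype]
  refine Fintype.card_congr ⟨fun g => ⟨g - g₀, ?_⟩, fun k => ⟨k + g₀, ?_⟩, fun g => ?_, fun k => ?_⟩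
  · rw [AddMonoidHom.mem_ker, map_sub, g.2, sub_self]
  · rw [map_add, k.2, zero_add]
  · simp
  · simp

end FiniteGroups

section QuadExp
open Complex Finset

/-- The function `k ↦ exp (2πi k² / (4a))` on integers modulo `2a`. -/
noncomputable def quadExp (a : ℤ) (k : ZMod (2 * a.natAbs)) : ℂ :=
  cexp (Real.pi * I * (k.val : ℂ) ^ 2 / (2 * a))

theorem quadExp_intCast {a : ℤ} (ha : a ≠ 0) (k : ℤ) :
    quadExp a (k : ZMod (2 * a.natAbs)) = cexp (Real.pi * I * (k : ℂ) ^ 2 / (2 * a)) := by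
  have hac : (a : ℂ) ≠ 0 := by exact_mod_cast ha
  have : NeZero (2 * a.natAbs) := ⟨by simp [ha]⟩
  have h1 : (((k : ZMod (2 * a.natAbs)).val : ℤ) : ZMod (2 * a.natAbs)) = (k : ZMod _) := by
    simp
  obtain ⟨d, hd⟩ := (ZMod.intCast_eq_intCast_iff_dvd_sub _ _ _).mp h1
  have h3 : (2 * a) ∣ ((2 * a.natAbs : ℕ) : ℤ) := by
    push_cast
    exact mul_dvd_mul_left _ (by simp)
  obtain ⟨d, hd⟩ : 2 * a ∣ k - ((k : ZMod (2 * a.natAbs)).val : ℤ) := h3.trans ⟨d, hd⟩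
  have hk : (((k : ZMod (2 * a.natAbs)).val : ℕ) : ℂ) = k - 2 * a * d := by
    have : (((k : ZMod (2 * a.natAbs)).val : ℕ) : ℤ) = k - 2 * a * d := by linarith
    exact_mod_cast this
  rw [quadExp, hk, Complex.exp_eq_exp_iff_exists_int]
  refine ⟨a * d ^ 2 - k * d, ?_⟩
  push_cast
  field_simp
  ring

theorem sum_quadExp {a : ℤ} (ha : a ≠ 0) [NeZero (2 * a.natAbs)] :
    ∃ ρ : ℝ, 0 < ρ ∧
      ∑ k, quadExp a k = ρ * cexp (Real.pi * I / 4 * (SignType.sign a : ℤ)) := by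
  have hpos : ∀ n : ℕ, n ≠ 0 → ∃ ρ : ℝ, 0 < ρ ∧
      ∑ k : Fin (2 * n), cexp (Real.pi * I * (k : ℂ) ^ 2 / (2 * n)) =
        ρ * cexp (Real.pi * I / 4) := by
    intro n hn
    have : NeZero n := ⟨hn⟩
    have : (0 : ℝ) < n := by exact_mod_cast Nat.pos_of_ne_zero hn
    exact ⟨Real.sqrt (2 * n), by positivity, sum_exp_sq_div n⟩
  obtain ⟨ρ, hρ, h⟩ := hpos a.natAbs (by simpa using ha)
  refine ⟨ρ, hρ, ?_⟩
  have hfin : ∑ k, quadExp a k = ∑ k : Fin (2 * a.natAbs),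
      cexp (Real.pi * I * (k : ℂ) ^ 2 / (2 * a)) := by
    rw [← Equiv.sum_comp (ZMod.finEquiv (2 * a.natAbs)).toEquiv]
    refine sum_congr rfl fun k _ => ?_
    have h0 : 2 * a.natAbs ≠ 0 := NeZero.ne _
    have : ((ZMod.finEquiv (2 * a.natAbs)) k).val = k := by
      clear * - h0
      revert k
      generalize 2 * a.natAbs = m at *
      intro k
      cases m with
      | zero => exact absurd rfl h0
      | succ m => rfl
    simp [quadExp, this]
  rw [hfin]
  rcases lt_or_gt_of_ne ha with ha | ha
  · have hc : (a : ℂ) = -(a.natAbs : ℂ) := by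
      have : a = -(a.natAbs : ℤ) := by omega
      exact_mod_cast this
    rw [sign_neg ha]
    have h' := congrArg (starRingEnd ℂ) h
    rw [map_sum, map_mul, ← exp_conj, conj_ofReal] at h'
    simp_rw [← exp_conj] at h'
    simp only [map_div₀, map_mul, map_pow, conj_ofReal, conj_I, map_natCast, map_ofNat] at h'
    rw [hc]
    convert h' using 2
    · refine congrArg cexp ?_
      rw [mul_neg, div_neg]
      ring
    · congr 1
      simp
      ring
  · have hc : (a : ℂ) = (a.natAbs : ℂ) := by
      rw [← Int.cast_natCast, Int.natAbs_of_nonneg ha.le]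
    rw [sign_pos ha, hc, h]
    simp

end QuadExp

section GaussMilgram
open Finset Complex

variable {K : Type*} [Field K] [NumberField K]

theorem exists_basis_trace_orthogonal {c : K} (hc : c ≠ 0) :
    ∃ b : Module.Basis (Fin (Module.finrank ℚ K)) ℚ K,
      (∀ i j, i ≠ j → Algebra.trace ℚ K (c * b i * b j) = 0) ∧
        ∀ i, Algebra.trace ℚ K (c * b i * b i) ≠ 0 := by
  let B : LinearMap.BilinForm ℚ K :=
    (Algebra.traceForm ℚ K).comp (LinearMap.mulLeft ℚ c) LinearMap.id
  have hB (x y : K) : B x y = Algebra.trace ℚ K (c * x * y) := rfl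
  obtain ⟨b, hb⟩ := LinearMap.BilinForm.exists_orthogonal_basis (B := B)
    ⟨fun x y => by rw [hB, hB]; simp; ring_nf⟩
  have horth : ∀ i j, i ≠ j → Algebra.trace ℚ K (c * b i * b j) = 0 := fun i j hij => hb hij
  refine ⟨b, horth, fun i hi => ?_⟩
  have h0 : ∀ x, Algebra.traceForm ℚ K (c * b i) x = 0 := by
    intro x
    rw [← b.sum_repr x, map_sum]
    refine sum_eq_zero fun j _ => ?_
    rw [map_smul, Algebra.traceForm_apply]
    by_cases hij : i = j
    · rw [← hij, hi, smul_zero]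
    · rw [horth i j hij, smul_zero]
  have := (traceForm_nondegenerate ℚ K).1 _ h0
  exact mul_ne_zero hc (b.ne_zero i) this

theorem basis_expansion_of_trace_orthogonal {ι : Type*} [Fintype ι] {c : K}
    (b : Module.Basis ι ℚ K)
    (horth : ∀ i j, i ≠ j → Algebra.trace ℚ K (c * b i * b j) = 0)
    (hne : ∀ i, Algebra.trace ℚ K (c * b i * b i) ≠ 0) (x : K) :
    x = ∑ i, (Algebra.trace ℚ K (c * x * b i) / Algebra.trace ℚ K (c * b i * b i)) • b i := by
  classical
  conv_lhs => rw [← b.sum_repr x]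
  refine sum_congr rfl fun i _ => ?_
  congr 1
  rw [eq_div_iff (hne i)]
  conv_rhs => rw [← b.sum_repr x, mul_sum, sum_mul, map_sum]
  rw [sum_eq_single i]
  · simp
  · intro j _ hj
    rw [mul_smul_comm, smul_mul_assoc, map_smul, horth j i hj, smul_zero]
  · simp

/-- The lattice of all `x` with `Tr (d x z) ∈ ℤ` for integral `z` has the ring of integers as its
dual. -/
theorem exists_integer_eq_of_trace_dual {d : K} (hd : d ≠ 0) {y : K}
    (hy : ∀ x : K, (∀ z : 𝓞 K, ∃ m : ℤ, Algebra.trace ℚ K (d * x * z) = m) →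
      ∃ m : ℤ, Algebra.trace ℚ K (d * y * x) = m) : ∃ z : 𝓞 K, y = z := by
  have h1 : (1 : FractionalIdeal (nonZeroDivisors (𝓞 K)) K) ≠ 0 := one_ne_zero
  have h : y ∈ FractionalIdeal.dual ℤ ℚ (FractionalIdeal.dual ℤ ℚ
      (1 : FractionalIdeal (nonZeroDivisors (𝓞 K)) K)) := by
    rw [FractionalIdeal.mem_dual (FractionalIdeal.dual_ne_zero ℤ ℚ h1)]
    intro a ha
    rw [FractionalIdeal.mem_dual h1] at ha
    obtain ⟨m, hm⟩ := hy (d⁻¹ * a) fun z => by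
      obtain ⟨m, hm⟩ := ha z (FractionalIdeal.mem_one_iff _ |>.mpr ⟨z, rfl⟩)
      refine ⟨m, ?_⟩
      rw [Algebra.traceForm_apply] at hm
      rw [mul_inv_cancel_left₀ hd, ← hm]
      simp
    refine ⟨m, ?_⟩
    rw [Algebra.traceForm_apply, show y * a = d * y * (d⁻¹ * a) by field_simp, hm]
    simp
  rw [FractionalIdeal.dual_dual, FractionalIdeal.mem_one_iff] at h
  obtain ⟨z, hz⟩ := h
  exact ⟨z, hz.symm⟩


/-- The additive character `x ↦ exp (2 π i x)` of `ℚ`. -/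
noncomputable def ratExp : AddChar ℚ ℂ where
  toFun x := cexp (2 * Real.pi * I * x)
  map_zero_eq_one' := by simp
  map_add_eq_mul' x y := by rw [← Complex.exp_add]; push_cast; ring_nf

theorem ratExp_apply (x : ℚ) : ratExp x = cexp (2 * Real.pi * I * x) := rfl

theorem ratExp_eq_one_iff {x : ℚ} : ratExp x = 1 ↔ ∃ m : ℤ, x = m := by
  rw [ratExp_apply, Complex.exp_eq_one_iff]
  refine exists_congr fun m => ?_
  have h : (2 * Real.pi * I : ℂ) ≠ 0 := Complex.two_pi_I_ne_zero
  rw [mul_comm, mul_left_inj' h]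
  norm_cast

theorem exists_basis_sum_eq {c : K} (hc : c ≠ 0) {R : Type*} [AddCommGroup R] [Fintype R]
    (π : 𝓞 K →+ R) (hπ : Function.Surjective π) (F : R → ℂ)
    (hF : ∀ x : 𝓞 K, F (π x) = ratExp (Algebra.trace ℚ K (c * x * x)))
    (hdiv : ∀ x : K, (∀ y : 𝓞 K, ∃ m : ℤ, Algebra.trace ℚ K (2 * c * x * y) = m) →
      ∃ z : 𝓞 K, x = 2 * z)
    (hker : ∀ x : 𝓞 K, π x = 0 → ∀ y : 𝓞 K, ∃ m : ℤ, Algebra.trace ℚ K (2 * c * x * y) = m) :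
    ∃ b : Module.Basis (Fin (Module.finrank ℚ K)) ℚ K,
      (∀ i j, i ≠ j → Algebra.trace ℚ K (c * b i * b j) = 0) ∧
      (∀ i, Algebra.trace ℚ K (c * b i * b i) ≠ 0) ∧
      ∃ ρ : ℝ, 0 < ρ ∧ ∑ r, F r = ρ * cexp (Real.pi * I / 4 *
        (∑ i, (SignType.sign (Algebra.trace ℚ K (c * b i * b i)) : ℤ) : ℤ)) := by
  classical
  obtain ⟨b₀, horth₀, hne₀⟩ := exists_basis_trace_orthogonal hc
  -- clear denominators so that the basis lies in the kernel of `π`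
  obtain ⟨b, horth, hne, β, hβ, hπβ⟩ :
      ∃ b : Module.Basis (Fin (Module.finrank ℚ K)) ℚ K,
      (∀ i j, i ≠ j → Algebra.trace ℚ K (c * b i * b j) = 0) ∧
      (∀ i, Algebra.trace ℚ K (c * b i * b i) ≠ 0) ∧
      ∃ β : Fin (Module.finrank ℚ K) → 𝓞 K, (∀ i, b i = β i) ∧ ∀ i, π (β i) = 0 := by
    have hd (i) : ∃ d : ℤ, d ≠ 0 ∧ ∃ z : 𝓞 K, (d : K) * b₀ i = z := by
      obtain ⟨d, hd, h⟩ := ((IsFractionRing.isAlgebraic_iff ℤ ℚ K).mpr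
        (Algebra.IsAlgebraic.isAlgebraic (R := ℚ) (b₀ i))).exists_integral_multiple
      exact ⟨d, hd, ⟨_, h⟩, by rw [← zsmul_eq_mul]; rfl⟩
    choose d hd0 z hz using hd
    have hN (i) : (Fintype.card R * d i : ℚ) ≠ 0 :=
      mul_ne_zero (Nat.cast_ne_zero.mpr Fintype.card_ne_zero) (Int.cast_ne_zero.mpr (hd0 i))
    let b := b₀.isUnitSMul fun i => (hN i).isUnit
    have hb (i) : b i = (Fintype.card R * d i : ℚ) • b₀ i := b₀.isUnitSMul_apply _ i
    refine ⟨b, fun i j hij => ?_, fun i => ?_, fun i => Fintype.card R * z i, fun i => ?_,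
      fun i => ?_⟩
    · rw [hb, hb, mul_smul_comm, mul_smul_comm, smul_mul_assoc, map_smul, map_smul,
        horth₀ i j hij, smul_zero, smul_zero]
    · rw [hb, mul_smul_comm, mul_smul_comm, smul_mul_assoc, map_smul, map_smul]
      exact smul_ne_zero (hN i) (smul_ne_zero (hN i) (hne₀ i))
    · rw [hb, Rat.smul_def]
      push_cast
      rw [mul_assoc, hz i]
    · simp only
      rw [← nsmul_eq_mul, map_nsmul, card_nsmul_eq_zero]
  refine ⟨b, horth, hne, ?_⟩
  have hbL (i) (y : 𝓞 K) : ∃ m : ℤ, Algebra.trace ℚ K (2 * c * b i * y) = m := by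
    rw [hβ]; exact hker _ (hπβ i) y
  have ha (i) : ∃ a : ℤ, Algebra.trace ℚ K (c * b i * b i) = a := by
    obtain ⟨z, hz⟩ := hdiv _ (hbL i)
    obtain ⟨m, hm⟩ := hbL i z
    refine ⟨m, ?_⟩
    rw [← hm]
    congr 1
    linear_combination c * b i * hz
  choose a ha using ha
  have ha0 (i) : a i ≠ 0 := fun h => hne i (by rw [ha, h, Int.cast_zero])
  have ht (i) (x : 𝓞 K) : ∃ m : ℤ, Algebra.trace ℚ K (2 * c * x * b i) = m := by
    obtain ⟨m, hm⟩ := hbL i x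
    exact ⟨m, by rw [← hm]; congr 1; ring⟩
  choose t ht using ht
  have htadd (i x y) : t i (x + y) = t i x + t i y := by
    apply Int.cast_injective (α := ℚ)
    push_cast
    rw [← ht, ← ht, ← ht, ← map_add]
    congr 1
    push_cast
    ring
  have hexp (x : K) (r : Fin (Module.finrank ℚ K) → ℚ)
      (hr : ∀ i, Algebra.trace ℚ K (2 * c * x * b i) = r i) :
      x = ∑ i, (r i / (2 * a i)) • b i := by
    conv_lhs => rw [basis_expansion_of_trace_orthogonal b horth hne x]
    refine sum_congr rfl fun i _ => ?_
    congr 1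
    rw [← hr, ha, show 2 * c * x * b i = (2 : ℚ) • (c * x * b i) by rw [Rat.smul_def]; push_cast; ring,
      map_smul, smul_eq_mul, mul_div_mul_left _ _ two_ne_zero]
  have htsq (x : 𝓞 K) : Algebra.trace ℚ K (c * x * x) = ∑ i, (t i x : ℚ) ^ 2 / (4 * a i) := by
    conv_lhs => enter [2, 2]; rw [hexp x (fun i => t i x) (fun i => ht i x)]
    rw [mul_sum, map_sum]
    refine sum_congr rfl fun i _ => ?_
    have h := ht i x
    rw [show 2 * c * x * b i = (2 : ℚ) • (c * x * b i) by rw [Rat.smul_def]; push_cast; ring,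
      map_smul, smul_eq_mul] at h
    rw [mul_smul_comm, map_smul, smul_eq_mul, ← mul_right_inj' (two_ne_zero' ℚ), mul_left_comm, h]
    have : (a i : ℚ) ≠ 0 := by exact_mod_cast ha0 i
    field_simp
    norm_num
  have _ (i) : NeZero (2 * (a i).natAbs) := ⟨by simp [ha0 i]⟩
  let f : 𝓞 K →+ (∀ i, ZMod (2 * (a i).natAbs)) :=
    AddMonoidHom.mk' (fun x i => (t i x : ZMod (2 * (a i).natAbs))) fun x y => by
      ext i; simp [htadd]
  have hf (x i) : f x i = (t i x : ZMod (2 * (a i).natAbs)) := rfl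
  let q (g : ∀ i, ZMod (2 * (a i).natAbs)) : ℂ := ∏ i, quadExp (a i) (g i)
  have hq (k : Fin (Module.finrank ℚ K) → ℤ) :
      q (fun i => (k i : ZMod (2 * (a i).natAbs))) = ratExp (∑ i, (k i : ℚ) ^ 2 / (4 * a i)) := by
    simp only [q]
    rw [ratExp_apply, Rat.cast_sum, mul_sum, Complex.exp_sum]
    refine prod_congr rfl fun i _ => ?_
    rw [quadExp_intCast (ha0 i)]
    have : (a i : ℂ) ≠ 0 := by exact_mod_cast ha0 i
    congr 1
    push_cast
    field_simp
    ring
  have hqf (x : 𝓞 K) : q (f x) = F (π x) := by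
    rw [hF, htsq, ← hq]; rfl
  -- the point of `K` with prescribed coordinates
  let pt (k : Fin (Module.finrank ℚ K) → ℤ) : K := ∑ i, ((k i : ℚ) / (2 * a i)) • b i
  have hpt (k i) : Algebra.trace ℚ K (2 * c * pt k * b i) = k i := by
    simp only [pt, mul_sum, sum_mul, map_sum]
    rw [sum_eq_single i]
    · have : (a i : ℚ) ≠ 0 := by exact_mod_cast ha0 i
      rw [mul_smul_comm, smul_mul_assoc, map_smul,
        show 2 * c * b i * b i = (2 : ℚ) • (c * b i * b i) by rw [Rat.smul_def]; push_cast; ring,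
        map_smul, ha, smul_eq_mul, smul_eq_mul]
      field_simp
    · intro j _ hj
      rw [mul_smul_comm, smul_mul_assoc, map_smul,
        show 2 * c * b j * b i = (2 : ℚ) • (c * b j * b i) by rw [Rat.smul_def]; push_cast; ring,
        map_smul, horth j i hj, smul_zero, smul_zero]
    · simp
  have hfpt (k : Fin (Module.finrank ℚ K) → ℤ) (x : 𝓞 K)
      (h : f x = fun i => (k i : ZMod (2 * (a i).natAbs))) :
      ∃ m : Fin (Module.finrank ℚ K) → ℤ, pt k = x - ∑ i, m i • b i := by
    have (i : Fin (Module.finrank ℚ K)) : ∃ m, t i x - k i = 2 * a i * m := by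
      have h1 := (ZMod.intCast_eq_intCast_iff_dvd_sub _ _ _).mp (congrFun h i)
      have h2 : (2 * a i) ∣ ((2 * (a i).natAbs : ℕ) : ℤ) := by
        push_cast
        exact mul_dvd_mul_left 2 (self_dvd_abs _)
      obtain ⟨m, hm⟩ := h2.trans h1
      exact ⟨-m, by linear_combination -hm⟩
    choose m hm using this
    refine ⟨m, ?_⟩
    rw [hexp x (fun i => t i x) (fun i => ht i x), ← sum_sub_distrib]
    refine sum_congr rfl fun i _ => ?_
    have h2 : (t i x : ℚ) = k i + 2 * a i * m i := by
      have := hm i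
      rw [sub_eq_iff_eq_add'] at this
      exact_mod_cast this
    have : (a i : ℚ) ≠ 0 := by exact_mod_cast ha0 i
    rw [← Int.cast_smul_eq_zsmul ℚ, ← sub_smul, h2]
    congr 1
    field_simp
    ring
  have hkerf : f.ker ≤ π.ker := by
    intro x hx
    obtain ⟨m, hm⟩ := hfpt 0 x (by rw [AddMonoidHom.mem_ker.mp hx]; ext i; simp)
    have : x = ∑ i, m i • β i := by
      apply RingOfIntegers.coe_injective
      simp only [pt, Pi.zero_apply, Int.cast_zero, zero_div, zero_smul, sum_const_zero, hβ] at hm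
      rw [eq_comm, sub_eq_zero] at hm
      refine hm.trans ?_
      simp
    rw [AddMonoidHom.mem_ker, this, map_sum]
    exact sum_eq_zero fun i _ => by rw [map_zsmul, hπβ, smul_zero]
  have hrange (k : Fin (Module.finrank ℚ K) → ℤ) :
      (fun i => (k i : ZMod (2 * (a i).natAbs))) ∈ f.range ↔ ∃ z : 𝓞 K, pt k = z := by
    constructor
    · rintro ⟨x, hx⟩
      obtain ⟨m, hm⟩ := hfpt k x hx
      exact ⟨x - ∑ i, m i • β i, by rw [hm]; simp [hβ]⟩
    · rintro ⟨z, hz⟩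
      refine ⟨z, ?_⟩
      ext i
      rw [hf]
      congr 1
      apply Int.cast_injective (α := ℚ)
      rw [← ht, ← hz, hpt]
  have hcadd (x y : 𝓞 K) : ((x + y : 𝓞 K) : K) = x + y := map_add (algebraMap (𝓞 K) K) x y
  let L : AddSubgroup (𝓞 K) :=
    { carrier := {x | ∀ y : 𝓞 K, ∃ m : ℤ, Algebra.trace ℚ K (2 * c * x * y) = m}
      zero_mem' := fun y => ⟨0, by simp⟩
      add_mem' := by
        intro x x' hx hx' y
        obtain ⟨m, hm⟩ := hx y
        obtain ⟨m', hm'⟩ := hx' y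
        exact ⟨m + m', by push_cast; rw [← hm, ← hm', mul_add, add_mul, map_add]⟩
      neg_mem' := by
        intro x hx y
        obtain ⟨m, hm⟩ := hx y
        exact ⟨-m, by push_cast; rw [← hm, mul_neg, neg_mul, map_neg]⟩ }
  have hLint (l : 𝓞 K) (hl : l ∈ L) : ∃ m : ℤ, Algebra.trace ℚ K (c * l * l) = m := by
    obtain ⟨z, hz⟩ := hdiv _ hl
    obtain ⟨m, hm⟩ := hl z
    refine ⟨m, ?_⟩
    rw [← hm]
    congr 1
    linear_combination c * l * hz
  have hshift (k : Fin (Module.finrank ℚ K) → ℤ) (l : 𝓞 K) (hl : l ∈ L) :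
      q ((fun i => (k i : ZMod (2 * (a i).natAbs))) + f l) =
        q (fun i => (k i : ZMod (2 * (a i).natAbs))) *
          ratExp (Algebra.trace ℚ K (2 * c * pt k * l)) := by
    have h1 : (fun i => (k i : ZMod (2 * (a i).natAbs))) + f l =
        fun i => ((k i + t i l : ℤ) : ZMod (2 * (a i).natAbs)) := by
      ext i; simp [hf]
    rw [h1, hq, hq, ← AddChar.map_add_eq_mul]
    have h2 : ratExp (Algebra.trace ℚ K (c * l * l)) = 1 := ratExp_eq_one_iff.mpr (hLint l hl)
    rw [← mul_one (ratExp (_ + _)), ← h2, ← AddChar.map_add_eq_mul]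
    congr 1
    have h3 : Algebra.trace ℚ K (2 * c * pt k * l) = ∑ i, (k i : ℚ) * t i l / (2 * a i) := by
      simp only [pt, mul_sum, sum_mul, map_sum]
      refine sum_congr rfl fun i _ => ?_
      rw [mul_smul_comm, smul_mul_assoc, map_smul, smul_eq_mul, mul_right_comm, ht]
      ring
    rw [htsq, h3, ← sum_add_distrib, ← sum_add_distrib]
    refine sum_congr rfl fun i _ => ?_
    have : (a i : ℚ) ≠ 0 := by exact_mod_cast ha0 i
    push_cast
    field_simp
    ring
  have hlift (g : ∀ i, ZMod (2 * (a i).natAbs)) : ∃ k : Fin (Module.finrank ℚ K) → ℤ,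
      g = fun i => (k i : ZMod (2 * (a i).natAbs)) :=
    ⟨fun i => (g i).val, by ext i; simp⟩
  have h2c : 2 * c ≠ 0 := mul_ne_zero two_ne_zero hc
  have hsum := sum_eq_sum_filter_of_isotropic q (L.map f) (· ∈ f.range) (by
      rintro g hg _ ⟨l, hl, rfl⟩
      obtain ⟨k, rfl⟩ := hlift g
      obtain ⟨z, hz⟩ := (hrange k).mp hg
      rw [hshift k l hl, ratExp_eq_one_iff.mpr, mul_one]
      obtain ⟨m, hm⟩ := hl z
      exact ⟨m, by rw [hz, ← hm, mul_right_comm]⟩) (by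
      intro g hg
      obtain ⟨k, rfl⟩ := hlift g
      rw [hrange] at hg
      have hex : ∃ x : K, (∀ z : 𝓞 K, ∃ m : ℤ, Algebra.trace ℚ K (2 * c * x * z) = m) ∧
          ¬ ∃ m : ℤ, Algebra.trace ℚ K (2 * c * pt k * x) = m := by
        by_contra! hcon
        refine hg (exists_integer_eq_of_trace_dual h2c fun x hx => ?_)
        exact hcon x hx
      obtain ⟨x, hx, hxn⟩ := hex
      obtain ⟨z, rfl⟩ := hdiv x hx
      have h2z : ((2 * z : 𝓞 K) : K) = 2 * z := map_mul (algebraMap (𝓞 K) K) 2 z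
      have hl : 2 * z ∈ L := fun y => by rw [h2z]; exact hx y
      refine ⟨_, ⟨2 * z, hl, rfl⟩, ratExp (Algebra.trace ℚ K (2 * c * pt k * (2 * z))),
        fun h => hxn (ratExp_eq_one_iff.mp h), ?_⟩
      rintro _ ⟨l, hl', rfl⟩
      rw [add_assoc, ← map_add, hshift k _ (add_mem hl' hl), hshift k l hl', mul_left_comm,
        ← AddChar.map_add_eq_mul, ← map_add]
      rw [← mul_add, hcadd, h2z, add_comm])
  obtain ⟨ρ, hρ, hρ'⟩ := exists_sum_range_eq_mul_sum f π hπ hkerf q F hqf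
  choose ρ' hρ0 hρ'' using fun i => sum_quadExp (ha0 i)
  have hprod : ∑ g, q g = (∏ i, ρ' i : ℝ) * cexp (Real.pi * I / 4 *
        (∑ i, (SignType.sign (Algebra.trace ℚ K (c * b i * b i)) : ℤ) : ℤ)) := by
    have : ∑ g, q g = ∏ i, ∑ k, quadExp (a i) k := by
      rw [prod_univ_sum, Fintype.piFinset_univ]
    rw [this, prod_congr rfl fun i _ => hρ'' i, prod_mul_distrib, ← Complex.exp_sum]
    push_cast
    rw [mul_sum]
    congr 2
    refine sum_congr rfl fun i _ => ?_
    rw [ha]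
    simp
  rw [hsum, hρ'] at hprod
  refine ⟨ρ⁻¹ * ∏ i, ρ' i, mul_pos (inv_pos.mpr hρ) (prod_pos fun i _ => hρ0 i), ?_⟩
  have hρc : (ρ : ℂ) ≠ 0 := by exact_mod_cast hρ.ne'
  rw [ofReal_mul, mul_assoc, ← hprod, ofReal_inv, inv_mul_cancel_left₀ hρc]

end GaussMilgram

section FiniteRings
open Finset

/-- The quadratic Gauss sum `∑ ψ (u x²)` over a finite commutative ring. -/
noncomputable def quadSum {R : Type*} [CommRing R] [Fintype R] (ψ : AddChar R ℂ) (u : R) : ℂ :=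
  ∑ x, ψ (u * x ^ 2)

theorem quadSum_prod {R R₁ R₂ : Type*} [CommRing R] [Fintype R] [CommRing R₁] [Fintype R₁]
    [CommRing R₂] [Fintype R₂] (e : R ≃+* R₁ × R₂) (ψ : AddChar R ℂ) (hψ : ψ.IsPrimitive) :
    ∃ (ψ₁ : AddChar R₁ ℂ) (ψ₂ : AddChar R₂ ℂ), ψ₁.IsPrimitive ∧ ψ₂.IsPrimitive ∧
      ∀ u, quadSum ψ u = quadSum ψ₁ (e u).1 * quadSum ψ₂ (e u).2 := by
  let ψ₁ := ψ.compAddMonoidHom (e.symm.toAddMonoidHom.comp (AddMonoidHom.inl R₁ R₂))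
  let ψ₂ := ψ.compAddMonoidHom (e.symm.toAddMonoidHom.comp (AddMonoidHom.inr R₁ R₂))
  have h₁ (x : R₁) : ψ₁ x = ψ (e.symm (x, 0)) := rfl
  have h₂ (x : R₂) : ψ₂ x = ψ (e.symm (0, x)) := rfl
  refine ⟨ψ₁, ψ₂, ?_, ?_, fun u => ?_⟩
  · intro a ha h
    refine hψ (a := e.symm (a, 0)) (by simpa using ha) ?_
    ext x
    have := DFunLike.congr_fun h (e x).1
    rw [AddChar.mulShift_apply, h₁, AddChar.one_apply] at this
    rw [AddChar.mulShift_apply, AddChar.one_apply, ← this]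
    congr 1
    apply e.injective
    simp [Prod.ext_iff]
  · intro a ha h
    refine hψ (a := e.symm (0, a)) (by simpa using ha) ?_
    ext x
    have := DFunLike.congr_fun h (e x).2
    rw [AddChar.mulShift_apply, h₂, AddChar.one_apply] at this
    rw [AddChar.mulShift_apply, AddChar.one_apply, ← this]
    congr 1
    apply e.injective
    simp [Prod.ext_iff]
  · rw [quadSum, quadSum, quadSum, sum_mul_sum, ← Equiv.sum_comp e.symm.toEquiv,
      Fintype.sum_prod_type]
    refine sum_congr rfl fun x _ => sum_congr rfl fun y _ => ?_
    rw [h₁, h₂, ← AddChar.map_add_eq_mul]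
    congr 1
    apply e.injective
    simp [Prod.ext_iff]

theorem quadSum_one_mul_quadSum_mul {R : Type*} [CommRing R] [Fintype R] (ψ : AddChar R ℂ)
    {s t α β : R} (h : s * α ^ 2 + t * β ^ 2 = 1) :
    quadSum ψ 1 * quadSum ψ (s * t) = quadSum ψ s * quadSum ψ t := by
  simp_rw [quadSum, sum_mul_sum, ← Fintype.sum_prod_type', ← AddChar.map_add_eq_mul]
  let e : R × R ≃ R × R :=
    { toFun := fun p => (α * p.1 - t * β * p.2, β * p.1 + s * α * p.2)
      invFun := fun p => (s * α * p.1 + t * β * p.2, α * p.2 - β * p.1)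
      left_inv := fun p => by
        ext
        · simp only; linear_combination p.1 * h
        · simp only; linear_combination p.2 * h
      right_inv := fun p => by
        ext
        · simp only; linear_combination p.1 * h
        · simp only; linear_combination p.2 * h }
  refine Eq.trans ?_ (Equiv.sum_comp e _)
  refine sum_congr rfl fun p _ => ?_
  congr 1
  simp only [e, Equiv.coe_fn_mk]
  linear_combination (-(p.1 ^ 2) - s * t * p.2 ^ 2) * h

theorem exists_sq_add_sq_eq_one_of_field {F : Type*} [Field F] [Fintype F]
    (hF : Odd (Fintype.card F)) {s t : F} (hs : s ≠ 0) (ht : t ≠ 0) :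
    ∃ α β : F, s * α ^ 2 + t * β ^ 2 = 1 := by
  open Polynomial in
  obtain ⟨a, b, h⟩ := FiniteField.exists_root_sum_quadratic
    (f := (C s * X ^ 2 : F[X])) (g := (C t * X ^ 2 - C 1 : F[X])) (by
      rw [degree_C_mul_X_pow 2 hs]; rfl) (by
      rw [degree_sub_eq_left_of_degree_lt] <;> rw [degree_C_mul_X_pow 2 ht]
      · rfl
      · exact lt_of_le_of_lt degree_C_le (by norm_num)) (Nat.odd_iff.mp hF)
  exact ⟨a, b, by simp at h; linear_combination h⟩

theorem exists_sq_add_sq_eq_one {R : Type*} [CommRing R] [Fintype R] (hR : Odd (Fintype.card R))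
    {s t : R} (hs : IsUnit s) (ht : IsUnit t) : ∃ α β : R, s * α ^ 2 + t * β ^ 2 = 1 := by
  classical
  have hodd (H : AddSubgroup R) : Odd (Nat.card H) :=
    Odd.of_dvd_nat (by rwa [← Nat.card_eq_fintype_card] at hR)
      (AddSubgroup.card_addSubgroup_dvd_card H)
  have hloc (m : MaximalSpectrum R) :
      ∃ αβ : (R ⧸ m.asIdeal) × (R ⧸ m.asIdeal), (Ideal.Quotient.mk _ s) * αβ.1 ^ 2 +
        (Ideal.Quotient.mk _ t) * αβ.2 ^ 2 = 1 := by
    have := m.isMaximal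
    let _ := Ideal.Quotient.field m.asIdeal
    let _ := Fintype.ofFinite (R ⧸ m.asIdeal)
    have hc : Odd (Fintype.card (R ⧸ m.asIdeal)) := by
      refine Odd.of_dvd_nat hR ?_
      rw [← Nat.card_eq_fintype_card, ← Nat.card_eq_fintype_card]
      exact AddSubgroup.card_quotient_dvd_card m.asIdeal.toAddSubgroup
    obtain ⟨α, β, h⟩ := exists_sq_add_sq_eq_one_of_field hc
      (hs.map (Ideal.Quotient.mk m.asIdeal)).ne_zero (ht.map (Ideal.Quotient.mk m.asIdeal)).ne_zero
    exact ⟨(α, β), h⟩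
  choose αβ hαβ using hloc
  let E := IsArtinianRing.quotNilradicalEquivPi R
  obtain ⟨α, hα⟩ := Ideal.Quotient.mk_surjective (E.symm fun m => (αβ m).1)
  obtain ⟨β, hβ⟩ := Ideal.Quotient.mk_surjective (E.symm fun m => (αβ m).2)
  have hE (x : R) (m : MaximalSpectrum R) :
      E (Ideal.Quotient.mk _ x) m = Ideal.Quotient.mk m.asIdeal x := by
    exact congrFun (E.commutes x) m
  have hnil : s * α ^ 2 + t * β ^ 2 - 1 ∈ nilradical R := by
    rw [← Ideal.Quotient.eq_zero_iff_mem]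
    apply E.injective
    ext m
    simp only [map_sub, map_add, map_mul, map_pow, map_one, map_zero, Pi.sub_apply, Pi.add_apply,
      Pi.mul_apply, Pi.pow_apply, Pi.one_apply, Pi.zero_apply, hα, hβ, AlgEquiv.apply_symm_apply]
    rw [hE, hE, hαβ, sub_self]
  have h2 : IsUnit (2 : R) := by
    obtain ⟨m, hm⟩ := hR
    have h0 : ((Fintype.card R : ℕ) : R) = 0 := by
      simp
    rw [hm] at h0
    push_cast at h0
    exact IsUnit.of_mul_eq_one (-(m : R)) (by linear_combination -h0)
  set w := s * α ^ 2 + t * β ^ 2 with hw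
  open Polynomial in
  obtain ⟨v, ⟨-, hv⟩, -⟩ := Polynomial.existsUnique_nilpotent_sub_and_aeval_eq_zero (S := R) (x := 1)
    (P := (X ^ 2 - C w : R[X])) (by
      rw [mem_nilradical, ← isNilpotent_neg_iff] at hnil
      simpa using hnil) (by simpa [derivative_X_pow, one_add_one_eq_two] using h2)
  have hv2 : v ^ 2 = w := by simpa [sub_eq_zero] using hv
  have hwu : IsUnit w := by
    simpa using (mem_nilradical.mp hnil).isUnit_add_one
  obtain ⟨v, rfl⟩ : IsUnit v := isUnit_pow_iff two_ne_zero |>.mp (hv2 ▸ hwu)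
  refine ⟨α * ↑v⁻¹, β * ↑v⁻¹, ?_⟩
  have hvv : (v : R) * ↑v⁻¹ = 1 := v.mul_inv
  linear_combination (-(↑v⁻¹ : R) ^ 2) * hw - (↑v⁻¹ : R) ^ 2 * hv2 + (v * ↑v⁻¹ + 1) * hvv

theorem quadSum_of_field {F : Type*} [Field F] [Fintype F] (hF : ringChar F ≠ 2)
    {ψ : AddChar F ℂ} (hψ : ψ.IsPrimitive) {u : F} (hu : u ≠ 0) :
    (IsSquare u ∧ quadSum ψ u = quadSum ψ 1) ∨ (¬ IsSquare u ∧ quadSum ψ u = - quadSum ψ 1) := by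
  classical
  by_cases hsq : IsSquare u
  · refine Or.inl ⟨hsq, ?_⟩
    obtain ⟨v, rfl⟩ := hsq
    have hv : v ≠ 0 := fun h => hu (by simp [h])
    rw [quadSum, quadSum, ← Equiv.sum_comp (Equiv.mulLeft₀ v hv) fun x => ψ (1 * x ^ 2)]
    refine sum_congr rfl fun x _ => ?_
    congr 1
    simp
    ring
  · refine Or.inr ⟨hsq, ?_⟩
    have h0 : ∑ y, ψ y = 0 := AddChar.sum_eq_zero_of_ne_one (by
      have := hψ one_ne_zero
      rwa [AddChar.mulShift_one] at this)
    have key (w : F) (hw : w ≠ 0) : quadSum ψ w =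
        ∑ y, ((quadraticChar F (w⁻¹ * y) + 1 : ℤ) : ℂ) * ψ y := by
      rw [quadSum, ← sum_fiberwise_of_maps_to (g := fun x => w * x ^ 2) (t := univ)
        (fun _ _ => mem_univ _)]
      refine sum_congr rfl fun y _ => ?_
      rw [sum_congr rfl fun x hx => by rw [(mem_filter.mp hx).2], sum_const, nsmul_eq_mul]
      congr 1
      rw [← quadraticChar_card_sqrts hF]
      simp only [Int.cast_natCast, Nat.cast_inj]
      congr 1
      ext x
      simp [eq_inv_mul_iff_mul_eq₀ hw]
    have h1 : quadraticChar F u⁻¹ = -1 := by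
      rw [quadraticChar_neg_one_iff_not_isSquare]
      simpa using hsq
    rw [key u hu, key 1 one_ne_zero, eq_neg_iff_add_eq_zero, ← sum_add_distrib]
    rw [← mul_zero (2 : ℂ), ← h0, mul_sum]
    refine sum_congr rfl fun y _ => ?_
    rw [map_mul, h1]
    push_cast
    simp
    ring

end FiniteRings

section Signature
open Finset Complex

variable {K : Type*} [Field K] [NumberField K]

open Classical in
theorem card_trace_pos_le {ι : Type*} [Fintype ι] (c : K) (b : ι → K)
    (horth : ∀ i j, i ≠ j → Algebra.trace ℚ K (c * b i * b j) = 0) :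
    #{i | 0 < Algebra.trace ℚ K (c * b i * b i)} ≤
      #{v : InfinitePlace K | v.IsReal → 0 ≤ (v.embedding c).re} := by
  set P : Finset ι := {i | 0 < Algebra.trace ℚ K (c * b i * b i)} with hP
  set V : Finset (InfinitePlace K) := {v | v.IsReal → 0 ≤ (v.embedding c).re} with hV
  by_contra! hlt
  choose w hw using fun v : InfinitePlace K => IsAlgClosed.exists_pow_nat_eq (v.embedding c) two_pos
  let T : (P → ℝ) →ₗ[ℝ] (V → ℝ) :=
    LinearMap.pi fun v => ∑ i : P, (w v * v.1.embedding (b i)).re • LinearMap.proj i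
  have hT : LinearMap.ker T ≠ ⊥ := LinearMap.ker_ne_bot_of_finrank_lt (by simpa using hlt)
  obtain ⟨x, hx, hx0⟩ := (Submodule.ne_bot_iff _).mp hT
  have hTx (v) (hv : v ∈ V) : ∑ i : P, (w v * v.embedding (b i)).re * x i = 0 := by
    simpa [T] using congrFun (LinearMap.mem_ker.mp hx) ⟨v, hv⟩
  let Z (φ : K →+* ℂ) : ℂ := ∑ i : P, φ (b i) * x i
  have hplace (v : InfinitePlace K) : (v.embedding c * Z v.embedding ^ 2).re ≤ 0 := by
    by_cases hv : v ∈ V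
    · have h0 : (w v * Z v.embedding).re = 0 := by
        rw [← hTx v hv, mul_sum, re_sum]
        refine sum_congr rfl fun i _ => ?_
        rw [← mul_assoc, re_mul_ofReal]
      rw [← hw, ← mul_pow, sq, mul_re, h0]
      nlinarith [sq_nonneg (w v * Z v.embedding).im]
    · simp only [hV, mem_filter, mem_univ, true_and, Classical.not_imp, not_le] at hv
      have hre (y : K) : v.embedding y = (v.embedding y).re := by
        rw [← InfinitePlace.embedding_of_isReal_apply hv.1, ofReal_re]
      have hZ : Z v.embedding = (∑ i : P, (v.embedding (b i)).re * x i : ℝ) := by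
        push_cast
        exact sum_congr rfl fun i _ => by rw [← hre]
      rw [hre c, hZ, ← ofReal_pow, ← ofReal_mul, ofReal_re]
      exact mul_nonpos_of_nonpos_of_nonneg hv.2.le (sq_nonneg _)
  have hemb (φ : K →+* ℂ) : (φ c * Z φ ^ 2).re ≤ 0 := by
    have h := hplace (InfinitePlace.mk φ)
    rcases InfinitePlace.embedding_mk_eq φ with h' | h' <;> rw [h'] at h
    · exact h
    · have : ComplexEmbedding.conjugate φ c * Z (ComplexEmbedding.conjugate φ) ^ 2 =
          starRingEnd ℂ (φ c * Z φ ^ 2) := by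
        simp [Z, ComplexEmbedding.conjugate_coe_eq]
      rwa [this, conj_re] at h
  have hsum : (∑ i : P, (Algebra.trace ℚ K (c * b i * b i) : ℝ) * x i ^ 2 : ℝ) =
      ∑ φ : K →ₐ[ℚ] ℂ, (φ c * Z φ ^ 2).re := by
    rw [← re_sum, ← ofReal_re (∑ i : P, _)]
    congr 1
    have htr (y : K) : ((Algebra.trace ℚ K y : ℚ) : ℂ) = ∑ φ : K →ₐ[ℚ] ℂ, φ y := by
      rw [← trace_eq_sum_embeddings ℂ]; simp
    have h1 (φ : K →ₐ[ℚ] ℂ) : φ c * Z φ ^ 2 =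
        ∑ i : P, ∑ j : P, φ (c * b i * b j) * (x i * x j) := by
      rw [sq, sum_mul_sum, mul_sum]
      refine sum_congr rfl fun i _ => ?_
      rw [mul_sum]
      refine sum_congr rfl fun j _ => ?_
      simp only [map_mul, RingHom.coe_coe]
      ring
    rw [sum_congr rfl fun φ _ => h1 φ, sum_comm, ofReal_sum]
    refine sum_congr rfl fun i _ => ?_
    rw [sum_comm, sum_eq_single i]
    · rw [← sum_mul, ← htr]
      push_cast
      ring
    · intro j _ hj
      rw [← sum_mul, ← htr, horth _ _ fun h => hj (Subtype.ext h.symm)]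
      simp
    · simp
  have hle : (∑ i : P, (Algebra.trace ℚ K (c * b i * b i) : ℝ) * x i ^ 2 : ℝ) ≤ 0 := by
    rw [hsum]
    exact sum_nonpos fun φ _ => hemb φ
  have hpos (i : P) : (0 : ℝ) < Algebra.trace ℚ K (c * b i * b i) := by
    have := i.2
    simp only [hP, mem_filter, mem_univ, true_and] at this
    exact_mod_cast this
  refine hx0 (funext fun i => ?_)
  have h0 := (sum_eq_zero_iff_of_nonneg fun i _ => mul_nonneg (hpos i).le (sq_nonneg (x i))).mp
    (le_antisymm hle (sum_nonneg fun i _ => mul_nonneg (hpos i).le (sq_nonneg (x i)))) i (mem_univ i)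
  simpa [(hpos i).ne'] using h0

open Classical in
theorem sum_sign_trace_eq {ι : Type*} [Fintype ι] {c : K} (hc : c ≠ 0) (b : ι → K)
    (hι : Fintype.card ι = Module.finrank ℚ K)
    (horth : ∀ i j, i ≠ j → Algebra.trace ℚ K (c * b i * b j) = 0)
    (hne : ∀ i, Algebra.trace ℚ K (c * b i * b i) ≠ 0) :
    ∑ i, (SignType.sign (Algebra.trace ℚ K (c * b i * b i)) : ℤ) =
      ∑ v : InfinitePlace K, if v.IsReal then (SignType.sign (v.embedding c).re : ℤ) else 0 := by
  have hp := card_trace_pos_le c b horth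
  have hn := card_trace_pos_le (-c) b (by simpa using horth)
  simp only [neg_mul, map_neg, Left.neg_pos_iff, neg_re, Left.nonneg_neg_iff] at hn
  have hre (v : InfinitePlace K) (hv : v.IsReal) : (v.embedding c).re ≠ 0 := by
    rw [← InfinitePlace.embedding_of_isReal_apply hv, ofReal_re]
    exact (map_ne_zero _).mpr hc
  have hι1 : #{i | 0 < Algebra.trace ℚ K (c * b i * b i)} +
      #{i | Algebra.trace ℚ K (c * b i * b i) < 0} = Module.finrank ℚ K := by
    rw [card_filter, card_filter, ← sum_add_distrib, ← hι, ← card_univ, card_eq_sum_ones]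
    refine sum_congr rfl fun i _ => ?_
    rcases (hne i).lt_or_gt with h | h <;> simp [h, h.not_gt]
  have hV1 : #{v : InfinitePlace K | v.IsReal → 0 ≤ (v.embedding c).re} +
      #{v : InfinitePlace K | v.IsReal → (v.embedding c).re ≤ 0} = Module.finrank ℚ K := by
    rw [card_filter, card_filter, ← sum_add_distrib, ← InfinitePlace.sum_mult_eq]
    refine sum_congr rfl fun v _ => ?_
    by_cases hv : v.IsReal
    · rcases (hre v hv).lt_or_gt with h | h <;> simp [InfinitePlace.mult, hv, h.le, h.not_ge]
    · simp [InfinitePlace.mult, hv]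
  have hι2 : ∑ i, (SignType.sign (Algebra.trace ℚ K (c * b i * b i)) : ℤ) =
      #{i | 0 < Algebra.trace ℚ K (c * b i * b i)} -
      (#{i | Algebra.trace ℚ K (c * b i * b i) < 0} : ℤ) := by
    rw [card_filter, card_filter]
    push_cast
    rw [← sum_sub_distrib]
    refine sum_congr rfl fun i _ => ?_
    rcases (hne i).lt_or_gt with h | h <;> simp [h, h.not_gt]
  have hV2 : (∑ v : InfinitePlace K,
      if v.IsReal then (SignType.sign (v.embedding c).re : ℤ) else 0) =
      #{v : InfinitePlace K | v.IsReal → 0 ≤ (v.embedding c).re} -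
      (#{v : InfinitePlace K | v.IsReal → (v.embedding c).re ≤ 0} : ℤ) := by
    rw [card_filter, card_filter]
    push_cast
    rw [← sum_sub_distrib]
    refine sum_congr rfl fun v _ => ?_
    by_cases hv : v.IsReal
    · rcases (hre v hv).lt_or_gt with h | h <;> simp [hv, h, h.le, h.not_ge]
    · simp [hv]
  rw [hι2, hV2]
  omega

end Signature

section IdealQuotients

theorem exists_sq_add_sq_eq_one_quotient {R : Type*} [CommRing R] {s t : R} {B : Ideal R}
    [Finite (R ⧸ B)] (h4 : 4 ∣ s - 1 ∨ 4 ∣ t - 1) (hB : IsCoprime (Ideal.span {2 * (s * t)}) B) :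
    ∃ α β : R ⧸ Ideal.span {4} * B, Ideal.Quotient.mk (Ideal.span {4} * B) s * α ^ 2 +
      Ideal.Quotient.mk (Ideal.span {4} * B) t * β ^ 2 = 1 := by
  have hunit : IsUnit (Ideal.Quotient.mk B (2 * (s * t))) := by
    obtain ⟨a, ha, b, hb, hab⟩ := Ideal.isCoprime_iff_exists.mp hB
    obtain ⟨r, rfl⟩ := Ideal.mem_span_singleton'.mp ha
    refine IsUnit.of_mul_eq_one (Ideal.Quotient.mk B r) ?_
    rw [← map_mul, ← map_one (Ideal.Quotient.mk B), Ideal.Quotient.eq, ← hab]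
    have : 2 * (s * t) * r - (r * (2 * (s * t)) + b) = -b := by ring
    rw [this]
    exact B.neg_mem hb
  rw [map_mul, map_mul, IsUnit.mul_iff, IsUnit.mul_iff] at hunit
  obtain ⟨h2, hs, ht⟩ := hunit
  rw [map_ofNat] at h2
  have hcop : IsCoprime (Ideal.span {4}) B := by
    have h : IsCoprime (Ideal.span {2}) B := by
      rw [← Ideal.span_singleton_mul_span_singleton] at hB
      exact hB.of_mul_left_left
    have h22 : (Ideal.span {4} : Ideal R) = Ideal.span {2} * Ideal.span {2} := by
      rw [Ideal.span_singleton_mul_span_singleton]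
      norm_num
    rw [h22]
    exact h.mul_left h
  let _ := Fintype.ofFinite (R ⧸ B)
  have hodd : Odd (Fintype.card (R ⧸ B)) := by
    rw [← Nat.not_even_iff_odd, even_iff_two_dvd]
    intro hdvd
    obtain ⟨x, hx⟩ := exists_prime_addOrderOf_dvd_card 2 hdvd
    have hx0 : (2 : R ⧸ B) * x = 0 := by
      have h := addOrderOf_nsmul_eq_zero x
      rwa [hx, nsmul_eq_mul, Nat.cast_ofNat] at h
    rw [h2.mul_right_eq_zero] at hx0
    rw [hx0, addOrderOf_zero] at hx
    norm_num at hx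
  obtain ⟨α₂, β₂, h₂⟩ := exists_sq_add_sq_eq_one hodd hs ht
  have h₁ : ∃ α β : R ⧸ (Ideal.span {4} : Ideal R), Ideal.Quotient.mk _ s * α ^ 2 +
      Ideal.Quotient.mk _ t * β ^ 2 = 1 := by
    have hone {x : R} (hx : 4 ∣ x - 1) : Ideal.Quotient.mk (Ideal.span {4}) x = 1 := by
      rw [← map_one (Ideal.Quotient.mk _), Ideal.Quotient.eq]
      exact Ideal.mem_span_singleton.mpr hx
    rcases h4 with h | h
    · exact ⟨1, 0, by simp [hone h]⟩
    · exact ⟨0, 1, by simp [hone h]⟩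
  obtain ⟨α₁, β₁, h₁⟩ := h₁
  let e := Ideal.quotientMulEquivQuotientProd (Ideal.span {4}) B hcop
  have he (x : R) : e (Ideal.Quotient.mk _ x) =
      (Ideal.Quotient.mk _ x, Ideal.Quotient.mk _ x) := rfl
  refine ⟨e.symm (α₁, α₂), e.symm (β₁, β₂), e.injective ?_⟩
  rw [map_add, map_mul, map_mul, map_pow, map_pow, he, he, e.apply_symm_apply, e.apply_symm_apply,
    map_one]
  exact Prod.ext h₁ h₂

theorem isSquare_iff_of_quadSum_mul_eq {R : Type*} [CommRing R] {s t : R} {I : Ideal R}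
    [hs : (Ideal.span {s}).IsMaximal] [ht : (Ideal.span {t}).IsMaximal]
    [Finite (R ⧸ Ideal.span {s})] [Finite (R ⧸ Ideal.span {t})] [Finite (R ⧸ I)]
    (hsc : ringChar (R ⧸ Ideal.span {s}) ≠ 2) (htc : ringChar (R ⧸ Ideal.span {t}) ≠ 2)
    (hst : Ideal.span {s} ≠ Ideal.span {t})
    (hsI : IsCoprime (Ideal.span {s}) I) (htI : IsCoprime (Ideal.span {t}) I)
    (hI : ∃ α β : R ⧸ I, Ideal.Quotient.mk I s * α ^ 2 + Ideal.Quotient.mk I t * β ^ 2 = 1)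
    [Fintype (R ⧸ Ideal.span {s} * (Ideal.span {t} * I))]
    {ψ : AddChar (R ⧸ Ideal.span {s} * (Ideal.span {t} * I)) ℂ} (hψ : ψ.IsPrimitive)
    {ρ : ℝ} (hρ : 0 < ρ)
    (h : quadSum ψ 1 * quadSum ψ (Ideal.Quotient.mk _ (s * t)) =
      ρ * (quadSum ψ (Ideal.Quotient.mk _ s) * quadSum ψ (Ideal.Quotient.mk _ t)))
    (h0 : quadSum ψ 1 * quadSum ψ (Ideal.Quotient.mk _ (s * t)) ≠ 0) :
    IsSquare (Ideal.Quotient.mk (Ideal.span {t}) s) ↔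
      IsSquare (Ideal.Quotient.mk (Ideal.span {s}) t) := by
  have hcop : IsCoprime (Ideal.span {s}) (Ideal.span {t}) :=
    Ideal.isCoprime_iff_sup_eq.mpr (hs.coprime_of_ne ht hst)
  have hfin : Finite (R ⧸ Ideal.span {t} * I) :=
    Finite.of_equiv _ (Ideal.quotientMulEquivQuotientProd _ _ htI).symm.toEquiv
  let _ := Fintype.ofFinite (R ⧸ Ideal.span {s})
  let _ := Fintype.ofFinite (R ⧸ Ideal.span {t})
  let _ := Fintype.ofFinite (R ⧸ I)
  let _ := Fintype.ofFinite (R ⧸ Ideal.span {t} * I)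
  let _ := Ideal.Quotient.field (Ideal.span {s})
  let _ := Ideal.Quotient.field (Ideal.span {t})
  obtain ⟨ψ₁, ψ', hψ₁, hψ', hG⟩ :=
    quadSum_prod (Ideal.quotientMulEquivQuotientProd _ _ (hcop.mul_right hsI)) ψ hψ
  obtain ⟨ψ₂, ψ₃, hψ₂, -, hG'⟩ := quadSum_prod (Ideal.quotientMulEquivQuotientProd _ _ htI) ψ' hψ'
  have key (x : R) : quadSum ψ (Ideal.Quotient.mk _ x) = quadSum ψ₁ (Ideal.Quotient.mk _ x) *
      (quadSum ψ₂ (Ideal.Quotient.mk _ x) * quadSum ψ₃ (Ideal.Quotient.mk _ x)) := by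
    rw [hG]
    congr 1
    exact hG' (Ideal.Quotient.mk _ x)
  obtain ⟨α, β, hαβ⟩ := hI
  have h3 := quadSum_one_mul_quadSum_mul ψ₃ hαβ
  have hs0 : Ideal.Quotient.mk (Ideal.span {s}) s = 0 :=
    Ideal.Quotient.eq_zero_iff_mem.mpr (Ideal.mem_span_singleton_self s)
  have ht0 : Ideal.Quotient.mk (Ideal.span {t}) t = 0 :=
    Ideal.Quotient.eq_zero_iff_mem.mpr (Ideal.mem_span_singleton_self t)
  have hs0' : Ideal.Quotient.mk (Ideal.span {t}) s ≠ 0 := fun h => by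
    rw [Ideal.Quotient.eq_zero_iff_mem, ← Ideal.span_singleton_le_iff_mem] at h
    exact hst (hs.eq_of_le ht.ne_top h)
  have ht0' : Ideal.Quotient.mk (Ideal.span {s}) t ≠ 0 := fun h => by
    rw [Ideal.Quotient.eq_zero_iff_mem, ← Ideal.span_singleton_le_iff_mem] at h
    exact hst (ht.eq_of_le hs.ne_top h).symm
  rw [← map_one (Ideal.Quotient.mk _), key, key] at h h0
  rw [key, key] at h
  simp only [map_mul, map_one, hs0, ht0, zero_mul, mul_zero] at h h0
  set X := quadSum ψ₁ 1 * (quadSum ψ₂ 1 * quadSum ψ₃ 1) * (quadSum ψ₁ 0 * (quadSum ψ₂ 0 *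
    quadSum ψ₃ (Ideal.Quotient.mk I s * Ideal.Quotient.mk I t))) with hX
  have hneg : X ≠ -(ρ * X) := fun hX => by
    have : (1 + ρ : ℂ) * X = 0 := by linear_combination hX
    rcases mul_eq_zero.mp this with h1 | h1
    · have : (1 + ρ : ℝ) = 0 := by exact_mod_cast h1
      linarith
    · exact h0 h1
  rcases quadSum_of_field htc hψ₂ hs0' with ⟨hs1, hs2⟩ | ⟨hs1, hs2⟩ <;>
  rcases quadSum_of_field hsc hψ₁ ht0' with ⟨ht1, ht2⟩ | ⟨ht1, ht2⟩
  · exact iff_of_true hs1 ht1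
  · refine absurd ?_ hneg
    rw [hs2, ht2] at h
    linear_combination h + ρ * quadSum ψ₁ 1 * quadSum ψ₂ 1 * quadSum ψ₁ 0 * quadSum ψ₂ 0 * h3
  · refine absurd ?_ hneg
    rw [hs2, ht2] at h
    linear_combination h + ρ * quadSum ψ₁ 1 * quadSum ψ₂ 1 * quadSum ψ₁ 0 * quadSum ψ₂ 0 * h3
  · exact iff_of_false hs1 ht1

theorem isSquare_mk_iff {R : Type*} [CommRing R] {I : Ideal R} {x : R} :
    IsSquare (Ideal.Quotient.mk I x) ↔ ∃ u, x - u ^ 2 ∈ I := by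
  simp_rw [isSquare_iff_exists_sq, Ideal.Quotient.mk_surjective.exists, ← map_pow,
    Ideal.Quotient.eq]

end IdealQuotients

section Reciprocity
open Finset Complex

variable {K : Type*} [Field K] [NumberField K]

open Classical in
/-- The sum of the signs of `c` at the real places. -/
noncomputable def realSignature (c : K) : ℤ :=
  ∑ v : InfinitePlace K, if v.IsReal then (SignType.sign (v.embedding c).re : ℤ) else 0

theorem realSignature_add {s t : K} (h : ∀ σ : K →+* ℝ, 0 < σ s ∨ 0 < σ t) (c : K) :
    realSignature c + realSignature (c * (s * t)) =
      realSignature (c * s) + realSignature (c * t) := by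
  classical
  simp_rw [realSignature, ← sum_add_distrib]
  refine sum_congr rfl fun v _ => ?_
  split_ifs with hv
  · have hre (y : K) : (v.embedding y).re = InfinitePlace.embedding_of_isReal hv y := by
      rw [← InfinitePlace.embedding_of_isReal_apply hv, ofReal_re]
    simp_rw [hre, map_mul, sign_mul]
    rcases h (InfinitePlace.embedding_of_isReal hv) with h | h <;>
      rw [sign_pos h] <;> simp [add_comm]
  · rfl

open nonZeroDivisors in
theorem trace_inv_mul_integral_iff {δ : 𝓞 K} (hδ : δ ≠ 0) {B : Ideal (𝓞 K)}
    (hB : differentIdeal ℤ (𝓞 K) * B = Ideal.span {δ}) (x : K) :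
    (∀ y : 𝓞 K, ∃ m : ℤ, Algebra.trace ℚ K ((δ : K)⁻¹ * x * y) = m) ↔ ∃ z ∈ B, x = (z : 𝓞 K) := by
  have hδ' : (δ : K) ≠ 0 := by simpa using hδ
  have h1 : (1 : FractionalIdeal (𝓞 K)⁰ K) ≠ 0 := one_ne_zero
  have hD := coeIdeal_differentIdeal ℤ ℚ K (𝓞 K)
  have hD0 : (differentIdeal ℤ (𝓞 K) : FractionalIdeal (𝓞 K)⁰ K) ≠ 0 := by
    rw [hD]; simp
  have hBf : (B : FractionalIdeal (𝓞 K)⁰ K) =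
      FractionalIdeal.spanSingleton (𝓞 K)⁰ (δ : K) * FractionalIdeal.dual ℤ ℚ 1 := by
    have h2 : (differentIdeal ℤ (𝓞 K) : FractionalIdeal (𝓞 K)⁰ K) * B =
        FractionalIdeal.spanSingleton (𝓞 K)⁰ (δ : K) := by
      rw [← FractionalIdeal.coeIdeal_mul, hB, FractionalIdeal.coeIdeal_span_singleton]
    rw [← h2, hD, mul_comm _ (B : FractionalIdeal (𝓞 K)⁰ K), mul_assoc, inv_mul_cancel₀, mul_one]
    exact FractionalIdeal.dual_ne_zero ℤ ℚ h1
  have h3 : (∃ z ∈ B, x = (z : 𝓞 K)) ↔ x ∈ (B : FractionalIdeal (𝓞 K)⁰ K) := by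
    rw [FractionalIdeal.mem_coeIdeal]
    simp only [eq_comm]
  rw [h3, hBf, FractionalIdeal.mem_singleton_mul]
  have h4 : (∀ y : 𝓞 K, ∃ m : ℤ, Algebra.trace ℚ K ((δ : K)⁻¹ * x * y) = m) ↔
      (δ : K)⁻¹ * x ∈ FractionalIdeal.dual ℤ ℚ (1 : FractionalIdeal (𝓞 K)⁰ K) := by
    rw [FractionalIdeal.mem_dual h1]
    constructor
    · rintro h _ ha
      obtain ⟨y, rfl⟩ := (FractionalIdeal.mem_one_iff _).mp ha
      obtain ⟨m, hm⟩ := h y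
      exact ⟨m, by rw [Algebra.traceForm_apply, hm]; rfl⟩
    · intro h y
      obtain ⟨m, hm⟩ := h y ((FractionalIdeal.mem_one_iff _).mpr ⟨y, rfl⟩)
      exact ⟨m, by rw [Algebra.traceForm_apply] at hm; rw [← hm]; rfl⟩
  rw [h4]
  constructor
  · intro h
    exact ⟨_, h, by field_simp⟩
  · rintro ⟨y, hy, rfl⟩
    rwa [inv_mul_cancel_left₀ hδ']

theorem trace_mul_inv_mul_integral_iff {δ : 𝓞 K} (hδ : δ ≠ 0) {B : Ideal (𝓞 K)}
    (hB : differentIdeal ℤ (𝓞 K) * B = Ideal.span {δ}) {k : K} (hk : k ≠ 0) (x : K) :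
    (∀ y : 𝓞 K, ∃ m : ℤ, Algebra.trace ℚ K ((k * δ)⁻¹ * x * y) = m) ↔
      ∃ z ∈ B, x = k * (z : 𝓞 K) := by
  have h := trace_inv_mul_integral_iff hδ hB (k⁻¹ * x)
  simp only [inv_mul_eq_iff_eq_mul₀ hk] at h
  rw [← h]
  refine forall_congr' fun y => ?_
  rw [mul_inv_rev, mul_assoc (δ : K)⁻¹]

/-- The character `x ↦ exp (2πi Tr (c x))` is a primitive character of `𝓞 K ⧸ A` when `A` is its
multiplicative kernel. -/
theorem exists_primitive_addChar {c : K} {A : Ideal (𝓞 K)}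
    (hA : ∀ x : 𝓞 K, x ∈ A ↔ ∀ y : 𝓞 K, ∃ m : ℤ, Algebra.trace ℚ K (c * x * y) = m) :
    ∃ ψ : AddChar (𝓞 K ⧸ A) ℂ, ψ.IsPrimitive ∧
      ∀ x : 𝓞 K, ψ (Ideal.Quotient.mk A x) = ratExp (Algebra.trace ℚ K (c * x)) := by
  have hadd (x y : 𝓞 K) : ((x + y : 𝓞 K) : K) = x + y := map_add (algebraMap (𝓞 K) K) x y
  have hmul (x y : 𝓞 K) : ((x * y : 𝓞 K) : K) = x * y := map_mul (algebraMap (𝓞 K) K) x y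
  let f : 𝓞 K → ℂ := fun x => ratExp (Algebra.trace ℚ K (c * x))
  have hf (x y : 𝓞 K) : f (x + y) = f x * f y := by
    simp only [f]
    rw [hadd, mul_add, map_add, AddChar.map_add_eq_mul]
  have hf1 (x : 𝓞 K) (hx : x ∈ A) : f x = 1 := by
    obtain ⟨m, hm⟩ := (hA x).mp hx 1
    exact ratExp_eq_one_iff.mpr ⟨m, by simpa using hm⟩
  have hfA (x y : 𝓞 K) (h : x - y ∈ A) : f x = f y := by
    rw [← sub_add_cancel x y, hf, hf1 _ h, one_mul]
  let ψ : AddChar (𝓞 K ⧸ A) ℂ :=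
    { toFun := Quotient.lift f fun x y h => hfA x y (by
        rwa [← Ideal.Quotient.eq, Ideal.Quotient.mk_eq_mk_iff_sub_mem, ← Submodule.quotientRel_def])
      map_zero_eq_one' := hf1 0 A.zero_mem
      map_add_eq_mul' := by
        intro a b
        obtain ⟨x, rfl⟩ := Ideal.Quotient.mk_surjective a
        obtain ⟨y, rfl⟩ := Ideal.Quotient.mk_surjective b
        exact hf x y }
  have hψ (x : 𝓞 K) : ψ (Ideal.Quotient.mk A x) = f x := rfl
  refine ⟨ψ, ?_, hψ⟩
  intro a ha h
  obtain ⟨x, rfl⟩ := Ideal.Quotient.mk_surjective a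
  refine ha (Ideal.Quotient.eq_zero_iff_mem.mpr ((hA x).mpr fun y => ?_))
  have := DFunLike.congr_fun h (Ideal.Quotient.mk A y)
  rw [AddChar.mulShift_apply, ← map_mul, hψ, AddChar.one_apply] at this
  obtain ⟨m, hm⟩ := ratExp_eq_one_iff.mp this
  exact ⟨m, by rw [← hm, hmul, mul_assoc]⟩

theorem quadSum_eq_exp_realSignature {δ : 𝓞 K} (hδ : δ ≠ 0) {B : Ideal (𝓞 K)}
    (hB : differentIdeal ℤ (𝓞 K) * B = Ideal.span {δ}) {u u' : 𝓞 K} (hu : u ≠ 0) (hu' : u' ≠ 0)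
    {c : K} (hc : c = (4 * ((u : K) * u') * δ)⁻¹) {A : Ideal (𝓞 K)} [Fintype (𝓞 K ⧸ A)]
    (hA : ∀ x : 𝓞 K, x ∈ A ↔ ∀ y : 𝓞 K, ∃ m : ℤ, Algebra.trace ℚ K (c * x * y) = m)
    {ψ : AddChar (𝓞 K ⧸ A) ℂ}
    (hψ : ∀ x : 𝓞 K, ψ (Ideal.Quotient.mk A x) = ratExp (Algebra.trace ℚ K (c * x))) :
    ∃ ρ : ℝ, 0 < ρ ∧ quadSum ψ (Ideal.Quotient.mk A u) =
      ρ * cexp (Real.pi * I / 4 * (realSignature (c * u) : ℤ)) := by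
  have hδK : (δ : K) ≠ 0 := by simpa using hδ
  have huK : (u : K) ≠ 0 := by simpa using hu
  have huK' : (u' : K) ≠ 0 := by simpa using hu'
  have hmul (x y : 𝓞 K) : ((x * y : 𝓞 K) : K) = x * y := map_mul (algebraMap (𝓞 K) K) x y
  have hc0 : c * u ≠ 0 := by
    simp [hc, hδK, huK, huK']
  have h2c : 2 * (c * u) = ((2 * u' : K) * δ)⁻¹ := by
    rw [hc]
    field_simp
    norm_num
  obtain ⟨b, horth, hne, ρ, hρ, h⟩ := exists_basis_sum_eq hc0
    (Ideal.Quotient.mk A : 𝓞 K →+ 𝓞 K ⧸ A) Ideal.Quotient.mk_surjective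
    (fun r => ψ (Ideal.Quotient.mk A u * r ^ 2))
    (fun x => by
      simp only [AddMonoidHom.coe_coe]
      rw [← map_pow, ← map_mul, hψ, sq, hmul, hmul]
      simp only [mul_assoc])
    (fun x hx => by
      rw [h2c] at hx
      obtain ⟨z, -, hz⟩ := (trace_mul_inv_mul_integral_iff hδ hB (by simpa using hu') x).mp hx
      exact ⟨u' * z, by rw [hz, hmul, mul_assoc]⟩)
    (fun x hx y => by
      obtain ⟨m, hm⟩ := (hA x).mp (Ideal.Quotient.eq_zero_iff_mem.mp hx) (2 * u * y)
      refine ⟨m, ?_⟩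
      rw [← hm, hmul, hmul]
      congr 1
      rw [show ((2 : 𝓞 K) : K) = 2 from map_ofNat (algebraMap (𝓞 K) K) 2]
      ring)
  refine ⟨ρ, hρ, ?_⟩
  rw [quadSum, h, sum_sign_trace_eq hc0 b (by simp) horth hne]
  rfl

theorem quadSum_mul_eq_pos_mul {δ : 𝓞 K} (hδ : δ ≠ 0) {B : Ideal (𝓞 K)}
    (hB : differentIdeal ℤ (𝓞 K) * B = Ideal.span {δ}) {s t : 𝓞 K} (hs : s ≠ 0) (ht : t ≠ 0)
    (h : ∀ σ : K →+* ℝ, 0 < σ s ∨ 0 < σ t)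
    {c : K} (hc : c = (4 * ((s : K) * t) * δ)⁻¹) {A : Ideal (𝓞 K)} [Fintype (𝓞 K ⧸ A)]
    (hA : ∀ x : 𝓞 K, x ∈ A ↔ ∀ y : 𝓞 K, ∃ m : ℤ, Algebra.trace ℚ K (c * x * y) = m)
    {ψ : AddChar (𝓞 K ⧸ A) ℂ}
    (hψ : ∀ x : 𝓞 K, ψ (Ideal.Quotient.mk A x) = ratExp (Algebra.trace ℚ K (c * x))) :
    ∃ ρ : ℝ, 0 < ρ ∧ quadSum ψ 1 * quadSum ψ (Ideal.Quotient.mk A (s * t)) =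
        ρ * (quadSum ψ (Ideal.Quotient.mk A s) * quadSum ψ (Ideal.Quotient.mk A t)) ∧
      quadSum ψ 1 * quadSum ψ (Ideal.Quotient.mk A (s * t)) ≠ 0 := by
  have hmul (x y : 𝓞 K) : ((x * y : 𝓞 K) : K) = x * y := map_mul (algebraMap (𝓞 K) K) x y
  have key {u u' : 𝓞 K} (hu : u ≠ 0) (hu' : u' ≠ 0) (huu : u * u' = s * t) :=
    quadSum_eq_exp_realSignature hδ hB hu hu' (by rw [hc, ← hmul, ← huu, hmul]) hA hψ
  obtain ⟨ρ₁, h₁, e₁⟩ := key one_ne_zero (mul_ne_zero hs ht) (one_mul _)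
  obtain ⟨ρ₂, h₂, e₂⟩ := key (mul_ne_zero hs ht) one_ne_zero (mul_one _)
  obtain ⟨ρ₃, h₃, e₃⟩ := key hs ht rfl
  obtain ⟨ρ₄, h₄, e₄⟩ := key ht hs (mul_comm _ _)
  have hsig := realSignature_add h c
  rw [map_one] at e₁
  rw [show ((1 : 𝓞 K) : K) = 1 from map_one (algebraMap (𝓞 K) K), mul_one] at e₁
  rw [hmul] at e₂
  have hE : cexp (Real.pi * I / 4 * (realSignature c : ℤ)) *
      cexp (Real.pi * I / 4 * (realSignature (c * (s * t)) : ℤ)) =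
      cexp (Real.pi * I / 4 * (realSignature (c * s) : ℤ)) *
        cexp (Real.pi * I / 4 * (realSignature (c * t) : ℤ)) := by
    rw [← Complex.exp_add, ← Complex.exp_add, ← mul_add, ← mul_add, ← Int.cast_add, ← Int.cast_add,
      hsig]
  have h₁' : (ρ₁ : ℂ) ≠ 0 := ofReal_ne_zero.mpr h₁.ne'
  have h₂' : (ρ₂ : ℂ) ≠ 0 := ofReal_ne_zero.mpr h₂.ne'
  have h₃' : (ρ₃ : ℂ) ≠ 0 := ofReal_ne_zero.mpr h₃.ne'
  have h₄' : (ρ₄ : ℂ) ≠ 0 := ofReal_ne_zero.mpr h₄.ne'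
  refine ⟨ρ₁ * ρ₂ / (ρ₃ * ρ₄), by positivity, ?_, ?_⟩
  · rw [e₁, e₂, e₃, e₄, mul_mul_mul_comm, hE]
    push_cast
    field_simp
  · rw [e₁, e₂]
    simp [h₁.ne', h₂.ne', Complex.exp_ne_zero]

/-- The inverse class of the different contains an integral ideal prime to a given element. -/
theorem exists_differentIdeal_mul_eq_span {a : 𝓞 K} (ha : a ≠ 0) (ha' : ¬ IsUnit a) :
    ∃ (δ : 𝓞 K) (B : Ideal (𝓞 K)), δ ≠ 0 ∧ differentIdeal ℤ (𝓞 K) * B = Ideal.span {δ} ∧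
      Ideal.span {a} ⊔ B = ⊤ := by
  have hD : differentIdeal ℤ (𝓞 K) ≠ ⊥ := differentIdeal_ne_bot
  obtain ⟨δ, hδ⟩ := IsDedekindDomain.exists_sup_span_eq
    (I := differentIdeal ℤ (𝓞 K) * Ideal.span {a}) (J := differentIdeal ℤ (𝓞 K))
    Ideal.mul_le_left (mul_ne_zero hD (by simpa using ha))
  obtain ⟨B, hB⟩ : differentIdeal ℤ (𝓞 K) ∣ Ideal.span {δ} :=
    Ideal.dvd_iff_le.mpr (le_sup_right.trans hδ.le)
  have hsup : Ideal.span {a} ⊔ B = ⊤ := by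
    rw [hB, ← Ideal.mul_sup] at hδ
    refine mul_left_cancel₀ hD ?_
    rw [hδ, Ideal.mul_top]
  refine ⟨δ, B, ?_, hB.symm, hsup⟩
  rintro rfl
  have hB0 : B = ⊥ := by
    simpa [hD] using hB.symm
  rw [hB0, sup_bot_eq, Ideal.span_singleton_eq_top] at hsup
  exact ha' hsup

end Reciprocity

/-- Lemma 2.3 (quadratic reciprocity law over a number field). -/
theorem stmt_2 (K : Type*) [Field K] [NumberField K]
    (s t : 𝓞 K)
    (hsp : (Ideal.span {s} : Ideal (𝓞 K)).IsPrime) (hs0 : Ideal.span {s} ≠ (⊥ : Ideal (𝓞 K)))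
    (htp : (Ideal.span {t} : Ideal (𝓞 K)).IsPrime) (ht0 : Ideal.span {t} ≠ (⊥ : Ideal (𝓞 K)))
    (hst : Ideal.span {s} ≠ (Ideal.span {t} : Ideal (𝓞 K)))
    (hsodd : ringChar (𝓞 K ⧸ (Ideal.span {s} : Ideal (𝓞 K))) ≠ 2)
    (htodd : ringChar (𝓞 K ⧸ (Ideal.span {t} : Ideal (𝓞 K))) ≠ 2)
    (h8 : (8 : 𝓞 K) ∣ s - 1 ∨ (8 : 𝓞 K) ∣ t - 1)
    (hreal : ∀ σ : K →+* ℝ, 0 < σ (algebraMap (𝓞 K) K s) ∨ 0 < σ (algebraMap (𝓞 K) K t)) :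
    (∃ u : 𝓞 K, s - u ^ 2 ∈ (Ideal.span {t} : Ideal (𝓞 K))) ↔
      ∃ w : 𝓞 K, t - w ^ 2 ∈ (Ideal.span {s} : Ideal (𝓞 K)) := by
  have hs : s ≠ 0 := by simpa using hs0
  have ht : t ≠ 0 := by simpa using ht0
  have hsm : (Ideal.span {s}).IsMaximal := hsp.isMaximal hs0
  have htm : (Ideal.span {t}).IsMaximal := htp.isMaximal ht0
  obtain ⟨δ, B, hδ, hB, hcop⟩ := exists_differentIdeal_mul_eq_span (a := 2 * (s * t))
    (by simp [hs, ht]) (by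
      rw [IsUnit.mul_iff, IsUnit.mul_iff]
      exact fun h => hsp.ne_top (Ideal.span_singleton_eq_top.mpr h.2.1))
  have hB0 : B ≠ ⊥ := by
    rintro rfl
    rw [Ideal.mul_bot] at hB
    exact hδ (Ideal.span_singleton_eq_bot.mp hB.symm)
  have h4 : (Ideal.span {4} : Ideal (𝓞 K)) ≠ ⊥ := by simp
  rw [← Ideal.isCoprime_iff_sup_eq] at hcop
  have hI : Ideal.span {4} * B ≠ ⊥ := mul_ne_zero h4 hB0
  have hA : Ideal.span {s} * (Ideal.span {t} * (Ideal.span {4} * B)) ≠ ⊥ :=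
    mul_ne_zero hs0 (mul_ne_zero ht0 hI)
  have _ := Ideal.finiteQuotientOfFreeOfNeBot _ hs0
  have _ := Ideal.finiteQuotientOfFreeOfNeBot _ ht0
  have _ := Ideal.finiteQuotientOfFreeOfNeBot _ hB0
  have _ := Ideal.finiteQuotientOfFreeOfNeBot _ hI
  have _ := Ideal.finiteQuotientOfFreeOfNeBot _ hA
  let _ := Fintype.ofFinite (𝓞 K ⧸ Ideal.span {s} * (Ideal.span {t} * (Ideal.span {4} * B)))
  have hpB : IsCoprime (Ideal.span {s}) B ∧ IsCoprime (Ideal.span {t}) B := by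
    rw [← Ideal.span_singleton_mul_span_singleton, ← Ideal.span_singleton_mul_span_singleton,
      IsCoprime.mul_left_iff, IsCoprime.mul_left_iff] at hcop
    exact hcop.2
  have hp4 {p : 𝓞 K} (hp : (Ideal.span {p}).IsMaximal)
      (hp2 : ringChar (𝓞 K ⧸ Ideal.span {p}) ≠ 2) :
      IsCoprime (Ideal.span {p}) (Ideal.span {4}) := by
    rw [Ideal.isCoprime_iff_sup_eq]
    by_contra hne
    have h4 : (4 : 𝓞 K) ∈ Ideal.span {p} := by
      rw [hp.eq_of_le hne le_sup_left]
      exact Ideal.mem_sup_right (Ideal.mem_span_singleton_self 4)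
    have h2 : (2 : 𝓞 K) ∈ Ideal.span {p} :=
      hp.isPrime.mem_of_pow_mem 2 (by norm_num; exact h4)
    have _ : Nontrivial (𝓞 K ⧸ Ideal.span {p}) := Ideal.Quotient.nontrivial_iff.mpr hp.ne_top
    exact hp2 (CharP.ringChar_of_prime_eq_zero Nat.prime_two (by
      rw [← Ideal.Quotient.eq_zero_iff_mem, map_ofNat] at h2
      exact_mod_cast h2))
  have hmul (x y : 𝓞 K) : ((x * y : 𝓞 K) : K) = x * y := map_mul (algebraMap (𝓞 K) K) x y
  have h4K : ((4 : 𝓞 K) : K) = 4 := map_ofNat (algebraMap (𝓞 K) K) 4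
  have hsK : (s : K) ≠ 0 := by simpa using hs
  have htK : (t : K) ≠ 0 := by simpa using ht
  have hmem (x : 𝓞 K) : x ∈ Ideal.span {s} * (Ideal.span {t} * (Ideal.span {4} * B)) ↔
      ∀ y : 𝓞 K, ∃ m : ℤ, Algebra.trace ℚ K ((4 * ((s : K) * t) * δ)⁻¹ * x * y) = m := by
    rw [trace_mul_inv_mul_integral_iff hδ hB (by simp [hs, ht])]
    simp only [Ideal.mem_span_singleton_mul]
    constructor
    · rintro ⟨_, ⟨_, ⟨z, hz, rfl⟩, rfl⟩, rfl⟩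
      refine ⟨z, hz, ?_⟩
      rw [hmul, hmul, hmul, h4K]
      ring
    · rintro ⟨z, hz, hx⟩
      refine ⟨_, ⟨_, ⟨z, hz, rfl⟩, rfl⟩, RingOfIntegers.ext ?_⟩
      rw [hmul, hmul, hmul, h4K, hx]
      ring
  obtain ⟨ψ, hψ, hψx⟩ := exists_primitive_addChar hmem
  obtain ⟨ρ, hρ, h, h0⟩ := quadSum_mul_eq_pos_mul hδ hB hs ht hreal rfl hmem hψx
  have h48 : (4 : 𝓞 K) ∣ 8 := ⟨2, by norm_num⟩
  rw [← isSquare_mk_iff, ← isSquare_mk_iff]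
  exact isSquare_iff_of_quadSum_mul_eq hsodd htodd hst ((hp4 hsm hsodd).mul_right hpB.1)
    ((hp4 htm htodd).mul_right hpB.2)
    (exists_sq_add_sq_eq_one_quotient (h8.imp h48.trans h48.trans) hcop) hψ hρ h h0
end
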